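/- arXiv:2301.02566 — 2 statements merged into one kernel-verified Lean document; each statement's English description precedes it below -/
import Mathlib

section
/- Let A and A_1 be PI-algebras over F such that T(A) = T(A_1)^n (the n-th power of the T-ideal T(A_1)). Then for every d >= 1, H(A; t_1,...,t_d) = SUM_{j=1}^{n} binom(n,j) (t_1 + ... + t_d - 1)^{j-1} H(A_1; t_1,...,t_d)^j. -/
/-- The set of polynomial identities of `A` in the free associative algebra `F⟨x_s : s ∈ S⟩`,
i.e. the elements vanishing under every `F`-algebra homomorphism to `A`, as an `F`-subspace
(it is in fact a two-sided ideal). -/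
def polyIdeal (F : Type) [Field F] (A : Type) [Ring A] [Algebra F A] (S : Type) :
    Submodule F (FreeAlgebra F S) where
  carrier := {f | ∀ φ : FreeAlgebra F S →ₐ[F] A, φ f = 0}
  add_mem' := by
    intro a b ha hb φ
    rw [map_add, ha φ, hb φ, add_zero]
  zero_mem' := by
    intro φ
    exact map_zero φ
  smul_mem' := by
    intro r a ha φ
    rw [map_smul, ha φ, smul_zero]

/-- The span of the words (noncommutative monomials) of multidegree `m` in the free algebra. -/
noncomputable def wordSpan (F : Type) [Field F] (S : Type) [DecidableEq S] (m : S →₀ ℕ) :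
    Submodule F (FreeAlgebra F S) :=
  Submodule.span F
    {x | ∃ w : List S, (∀ s : S, w.count s = m s) ∧ x = (w.map (FreeAlgebra.ι F)).prod}

/-- The Hilbert series of the quotient of the free algebra `F⟨x_s : s ∈ S⟩` by the (multigraded)
subspace `I`: the coefficient of the monomial `m` is the dimension of the image in the quotient
of the span of the words of multidegree `m`. -/
noncomputable def gradedSeries (F : Type) [Field F] (S : Type) [DecidableEq S]
    (I : Submodule F (FreeAlgebra F S)) : MvPowerSeries S ℚ :=
  fun m =>
    (Module.finrank F (↥(wordSpan F S m) ⧸ (I.comap (wordSpan F S m).subtype)) : ℚ)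

/-- The Hilbert series `H(A; t_1, …, t_d)` of the relatively free algebra
`F_d(A) = F⟨x_1,…,x_d⟩/(F⟨x_1,…,x_d⟩ ∩ T(A))`. -/
noncomputable def hilbertSeries (F : Type) [Field F] (A : Type) [Ring A] [Algebra F A]
    (d : ℕ) : MvPowerSeries (Fin d) ℚ :=
  gradedSeries F (Fin d) (polyIdeal F A (Fin d))

open Module DirectSum

namespace FreeAlgebraHilbert

section Words

variable (F : Type) [Field F] {S : Type}

/-- The noncommutative monomial attached to a word. -/
noncomputable def monomial (w : List S) : FreeAlgebra F S := (w.map (FreeAlgebra.ι F)).prod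

@[simp] theorem monomial_nil : monomial F ([] : List S) = 1 := rfl

@[simp] theorem monomial_cons (s : S) (w : List S) :
    monomial F (s :: w) = FreeAlgebra.ι F s * monomial F w := by
  simp [monomial]

theorem monomial_append (u v : List S) :
    monomial F (u ++ v) = monomial F u * monomial F v := by
  simp [monomial]

variable (S) in
/-- The basis of the free algebra consisting of the monomials. -/
noncomputable def wordBasis : Basis (List S) F (FreeAlgebra F S) :=
  (FreeAlgebra.basisFreeMonoid F S).reindex FreeMonoid.toList

@[simp] theorem wordBasis_apply (w : List S) : wordBasis F S w = monomial F w := by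
  simp [wordBasis, FreeAlgebra.basisFreeMonoid, FreeAlgebra.equivMonoidAlgebraFreeMonoid,
    monomial, FreeMonoid.lift_apply]

/-- The multidegree of a word. -/
noncomputable def wordDegree (w : List S) : S →₀ ℕ := (w.map fun s => Finsupp.single s 1).sum

@[simp] theorem wordDegree_nil : wordDegree ([] : List S) = 0 := rfl

@[simp] theorem wordDegree_cons (s : S) (w : List S) :
    wordDegree (s :: w) = Finsupp.single s 1 + wordDegree w := by
  simp [wordDegree]

theorem wordDegree_append (u v : List S) :
    wordDegree (u ++ v) = wordDegree u + wordDegree v := by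
  simp [wordDegree]

theorem count_eq_iff_wordDegree [DecidableEq S] (w : List S) (m : S →₀ ℕ) :
    (∀ s, w.count s = m s) ↔ wordDegree w = m := by
  have h : ∀ s, wordDegree w s = w.count s := by
    intro s
    induction w with
    | nil => simp
    | cons t w ih => simp [ih, List.count_cons, Finsupp.single_apply, add_comm]
  rw [DFunLike.ext_iff]
  simp [h]

theorem wordSpan_eq_span_image [DecidableEq S] (m : S →₀ ℕ) :
    wordSpan F S m = Submodule.span F (monomial F '' {w | wordDegree w = m}) := by
  unfold wordSpan
  congr 1
  ext x
  simp [count_eq_iff_wordDegree, monomial, eq_comm]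

theorem monomial_mem_wordSpan [DecidableEq S] (w : List S) :
    monomial F w ∈ wordSpan F S (wordDegree w) := by
  rw [wordSpan_eq_span_image]
  exact Submodule.subset_span ⟨w, rfl, rfl⟩

theorem ι_mem_wordSpan [DecidableEq S] (s : S) :
    FreeAlgebra.ι F s ∈ wordSpan F S (Finsupp.single s 1) := by
  simpa using monomial_mem_wordSpan F [s]

variable {F} in
theorem monomial_induction {p : FreeAlgebra F S → Prop} (f : FreeAlgebra F S)
    (zero : p 0) (add : ∀ f g, p f → p g → p (f + g))
    (smul : ∀ (c : F) w, p (c • monomial F w)) : p f := by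
  have hf : f ∈ Submodule.span F (Set.range (wordBasis F S)) := by simp [Basis.span_eq]
  induction hf using Submodule.span_induction with
  | mem x hx => obtain ⟨w, rfl⟩ := hx; simpa using smul 1 w
  | zero => exact zero
  | add x y _ _ hx hy => exact add _ _ hx hy
  | smul c x hx ih =>
    clear ih
    induction hx using Submodule.span_induction generalizing c with
    | mem x hx => obtain ⟨w, rfl⟩ := hx; simpa using smul c w
    | zero => simpa using zero
    | add x y _ _ hx hy => rw [smul_add]; exact add _ _ (hx c) (hy c)
    | smul d x _ hx => rw [smul_smul]; exact hx _

instance gradedMonoid_wordSpan [DecidableEq S] : SetLike.GradedMonoid (wordSpan F S) where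
  one_mem := by simpa using monomial_mem_wordSpan F ([] : List S)
  mul_mem a b x y hx hy := by
    have h : wordSpan F S a * wordSpan F S b ≤ wordSpan F S (a + b) := by
      simp only [wordSpan_eq_span_image, Submodule.span_mul_span]
      refine Submodule.span_mono ?_
      rintro _ ⟨_, ⟨u, rfl, rfl⟩, _, ⟨v, rfl, rfl⟩, rfl⟩
      exact ⟨u ++ v, wordDegree_append u v, monomial_append F u v⟩
    exact h (Submodule.mul_mem_mul hx hy)

/-- The algebra homomorphism decomposing a polynomial into multihomogeneous components. -/
noncomputable def decomposeHom [DecidableEq S] :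
    FreeAlgebra F S →ₐ[F] ⨁ m, wordSpan F S m :=
  FreeAlgebra.lift F fun s =>
    DirectSum.of (fun m => wordSpan F S m) (Finsupp.single s 1) ⟨_, ι_mem_wordSpan F s⟩

theorem decomposeHom_monomial [DecidableEq S] (w : List S) :
    decomposeHom F (monomial F w) =
      DirectSum.of (fun m => wordSpan F S m) (wordDegree w) ⟨_, monomial_mem_wordSpan F w⟩ := by
  induction w with
  | nil => simp; rfl
  | cons s w ih =>
    refine (congrArg _ (monomial_cons F s w)).trans ?_
    rw [map_mul, ih]
    simp only [decomposeHom, FreeAlgebra.lift_ι_apply, DirectSum.of_mul_of]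
    exact DirectSum.of_eq_of_gradedMonoid_eq
      (Sigma.subtype_ext (wordDegree_cons s w).symm (monomial_cons F s w).symm)

noncomputable instance gradedAlgebra_wordSpan [DecidableEq S] : GradedAlgebra (wordSpan F S) :=
  GradedAlgebra.ofAlgHom _ (decomposeHom F)
    (by ext s; simp [decomposeHom])
    (by
      rintro m ⟨x, hx⟩
      have hx' := hx
      rw [wordSpan_eq_span_image] at hx'
      induction hx' using Submodule.span_induction with
      | mem x h =>
        obtain ⟨w, rfl, rfl⟩ := h
        exact decomposeHom_monomial F w
      | zero => simp only [map_zero]; exact (map_zero _).symm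
      | add x y h h' ihx ihy =>
        rw [← wordSpan_eq_span_image] at h h'
        exact (map_add _ x y).trans
          ((congrArg₂ (· + ·) (ihx h) (ihy h')).trans (map_add _ _ _).symm)
      | smul c x h ih =>
        rw [← wordSpan_eq_span_image] at h
        refine (map_smul _ c x).trans ((congrArg (c • ·) (ih h)).trans ?_)
        exact (map_smul (DirectSum.lof F _ (fun m => wordSpan F S m) m) c ⟨x, h⟩).symm)

theorem finite_wordDegree_fiber [Finite S] (m : S →₀ ℕ) : {w : List S | wordDegree w = m}.Finite := by
  classical
  refine (List.finite_length_eq S (∑ s ∈ m.support, m s)).subset ?_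
  rintro w rfl
  have : ∀ w : List S, w.length = (wordDegree w).degree := by
    intro w
    induction w with
    | nil => simp
    | cons s w ih => simp [ih, Finsupp.degree_single, add_comm]
  simpa [Finsupp.degree_apply] using this w

instance finite_wordSpan [Finite S] [DecidableEq S] (m : S →₀ ℕ) :
    Module.Finite F (wordSpan F S m) := by
  rw [wordSpan_eq_span_image]
  exact FiniteDimensional.span_of_finite F ((finite_wordDegree_fiber m).image _)

theorem repr_nil (f : FreeAlgebra F S) :
    (wordBasis F S).repr f [] = FreeAlgebra.algebraMapInv f := by
  induction f using monomial_induction with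
  | zero => simp
  | add f g hf hg => simp [hf, hg]
  | smul c w =>
    rw [map_smul, ← wordBasis_apply, Basis.repr_self]
    cases w <;> simp [FreeAlgebra.algebraMapInv]

end Words

section Freeness

variable (F : Type) [Field F] {S : Type} [DecidableEq S]

/-- The linear map deleting the first letter of a word if this letter is `s`, and annihilating
all other words. -/
noncomputable def stripLeft (s : S) : FreeAlgebra F S →ₗ[F] FreeAlgebra F S :=
  (wordBasis F S).constr F fun w => if w.head? = some s then monomial F w.tail else 0

theorem stripLeft_monomial (s : S) (w : List S) :
    stripLeft F s (monomial F w) = if w.head? = some s then monomial F w.tail else 0 := by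
  rw [← wordBasis_apply, stripLeft, Basis.constr_basis]

theorem eq_algebraMapInv_add_sum [Fintype S] (f : FreeAlgebra F S) :
    f = algebraMap F _ (FreeAlgebra.algebraMapInv f) +
      ∑ s, FreeAlgebra.ι F s * stripLeft F s f := by
  induction f using monomial_induction with
  | zero => simp
  | add f g hf hg =>
    conv_lhs => rw [hf, hg]
    simp only [map_add, mul_add, Finset.sum_add_distrib]
    abel
  | smul c w =>
    simp only [map_smul, stripLeft_monomial]
    cases w with
    | nil => simp [Algebra.algebraMap_eq_smul_one]
    | cons t w => simp [FreeAlgebra.algebraMapInv]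

theorem repr_cons (f : FreeAlgebra F S) (s : S) (u : List S) :
    (wordBasis F S).repr f (s :: u) = (wordBasis F S).repr (stripLeft F s f) u := by
  induction f using monomial_induction with
  | zero => simp
  | add f g hf hg => simp [hf, hg]
  | smul c w =>
    rw [map_smul, map_smul, stripLeft_monomial, map_smul]
    simp only [← wordBasis_apply, Basis.repr_self]
    cases w with
    | nil => simp
    | cons t w =>
      by_cases h : t = s
      · subst h
        simp [Finsupp.single_apply, -wordBasis_apply]
      · simp [h]

theorem stripLeft_ι_mul (s t : S) (f : FreeAlgebra F S) :
    stripLeft F s (FreeAlgebra.ι F t * f) = if t = s then f else 0 := by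
  induction f using monomial_induction with
  | zero => simp
  | add f g hf hg => rw [mul_add, map_add, hf, hg]; split_ifs <;> simp
  | smul c w =>
    rw [mul_smul_comm, map_smul, ← monomial_cons, stripLeft_monomial]
    by_cases h : t = s <;> simp [h]

variable {F}

/-- The subspace spanned by the products of a variable with an element of `J`. -/
def varMul (J : Submodule F (FreeAlgebra F S)) : Submodule F (FreeAlgebra F S) :=
  Submodule.span F {x | ∃ s, ∃ g ∈ J, x = FreeAlgebra.ι F s * g}

/-- Elements of a left ideal `J` that are linearly independent modulo `varMul J` are left linearly
independent over the free algebra. -/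
theorem linearIndependent_of_mkQ_varMul [Fintype S] {J : Submodule F (FreeAlgebra F S)}
    (hJ : ∀ r, ∀ x ∈ J, r * x ∈ J) {κ : Type} {w : κ → FreeAlgebra F S} (hw : ∀ k, w k ∈ J)
    (hli : LinearIndependent F fun k => (varMul J).mkQ (w k)) :
    LinearIndependent (FreeAlgebra F S) w := by
  have hmem : ∀ l : κ →₀ FreeAlgebra F S, Finsupp.linearCombination _ w l ∈ J := by
    intro l
    rw [Finsupp.linearCombination_apply]
    exact J.sum_mem fun k _ => hJ _ _ (hw k)
  have hdecomp : ∀ l : κ →₀ FreeAlgebra F S, Finsupp.linearCombination (FreeAlgebra F S) w l =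
      Finsupp.linearCombination F w
        (Finsupp.mapRange.linearMap FreeAlgebra.algebraMapInv.toLinearMap l) +
      ∑ s, FreeAlgebra.ι F s * Finsupp.linearCombination (FreeAlgebra F S) w
        (Finsupp.mapRange.linearMap (stripLeft F s) l) := by
    intro l
    induction l using Finsupp.induction_linear with
    | zero => simp
    | add f g hf hg =>
      simp only [map_add, mul_add, Finset.sum_add_distrib]
      rw [hf, hg]
      abel
    | single k c =>
      simp only [Finsupp.linearCombination_single, Finsupp.mapRange.linearMap_apply,
        Finsupp.mapRange_single, smul_eq_mul, ← mul_assoc, ← Finset.sum_mul]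
      conv_lhs => rw [eq_algebraMapInv_add_sum F c]
      rw [add_mul, Algebra.smul_def]
      rfl
  have key : ∀ (u : List S) (l : κ →₀ FreeAlgebra F S),
      Finsupp.linearCombination (FreeAlgebra F S) w l = 0 →
      ∀ k, (wordBasis F S).repr (l k) u = 0 := by
    intro u
    have heps : ∀ l : κ →₀ FreeAlgebra F S,
        Finsupp.linearCombination (FreeAlgebra F S) w l = 0 →
        Finsupp.mapRange.linearMap FreeAlgebra.algebraMapInv.toLinearMap l = 0 := by
      intro l hl
      refine linearIndependent_iff.mp hli _ ?_
      have h := hdecomp l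
      rw [hl] at h
      have h' : Finsupp.linearCombination F w
          (Finsupp.mapRange.linearMap FreeAlgebra.algebraMapInv.toLinearMap l) ∈ varMul J := by
        rw [eq_neg_of_add_eq_zero_left h.symm]
        exact neg_mem (sum_mem fun s _ => Submodule.subset_span ⟨s, _, hmem _, rfl⟩)
      rw [← Submodule.Quotient.mk_eq_zero, ← Submodule.mkQ_apply,
        Finsupp.apply_linearCombination] at h'
      exact h'
    induction u with
    | nil =>
      intro l hl k
      simpa [repr_nil] using DFunLike.congr_fun (heps l hl) k
    | cons s u ih =>
      intro l hl k
      have h := hdecomp l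
      rw [hl, heps l hl, map_zero, zero_add] at h
      have h' := congrArg (stripLeft F s) h
      simp only [map_zero, map_sum, stripLeft_ι_mul, Finset.sum_ite_eq', Finset.mem_univ,
        if_true] at h'
      rw [repr_cons]
      exact ih _ h'.symm k
  rw [linearIndependent_iff]
  intro l hl
  ext k
  have : (wordBasis F S).repr (l k) = 0 := Finsupp.ext fun u => key u l hl k
  simpa using this

end Freeness

section GeneratingSeries

variable {S : Type}

/-- The generating series of a family of multidegrees. -/
noncomputable def genSeries {κ : Type} (D : κ → S →₀ ℕ) : MvPowerSeries S ℚ :=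
  fun m => (Nat.card {k // D k = m} : ℚ)

theorem coeff_genSeries {κ : Type} (D : κ → S →₀ ℕ) (m : S →₀ ℕ) :
    MvPowerSeries.coeff m (genSeries D) = (Nat.card {k // D k = m} : ℚ) := rfl

theorem genSeries_sum {κ κ' : Type} (D : κ → S →₀ ℕ) (D' : κ' → S →₀ ℕ)
    (hD : ∀ m, Finite {k // D k = m}) (hD' : ∀ m, Finite {k // D' k = m}) :
    genSeries (Sum.elim D D') = genSeries D + genSeries D' := by
  ext m
  rw [map_add]
  simp only [coeff_genSeries]
  have : Finite {k // Sum.elim D D' (Sum.inl k) = m} := hD m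
  have : Finite {k // Sum.elim D D' (Sum.inr k) = m} := hD' m
  rw [Nat.card_congr (Equiv.subtypeSum (p := fun k => Sum.elim D D' k = m)), Nat.card_sum]
  simp

theorem genSeries_congr {κ κ' : Type} (e : κ ≃ κ') (D : κ → S →₀ ℕ) (D' : κ' → S →₀ ℕ)
    (h : ∀ k, D' (e k) = D k) : genSeries D = genSeries D' := by
  ext m
  simp only [coeff_genSeries]
  rw [Nat.card_congr (e.subtypeEquiv (q := fun k => D' k = m) fun k => by rw [h])]

theorem genSeries_prod [DecidableEq S] {κ κ' : Type} (D : κ → S →₀ ℕ) (D' : κ' → S →₀ ℕ)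
    (hD : ∀ m, Finite {k // D k = m}) (hD' : ∀ m, Finite {k // D' k = m}) :
    genSeries (fun p : κ × κ' => D p.1 + D' p.2) = genSeries D * genSeries D' := by
  ext m
  rw [MvPowerSeries.coeff_mul]
  simp only [coeff_genSeries]
  let e : {p : κ × κ' // D p.1 + D' p.2 = m} ≃
      Σ q : Finset.HasAntidiagonal.antidiagonal m, {k // D k = q.1.1} × {k // D' k = q.1.2} :=
    { toFun := fun p => ⟨⟨(D p.1.1, D' p.1.2), Finset.HasAntidiagonal.mem_antidiagonal.2 p.2⟩,
        ⟨p.1.1, rfl⟩, ⟨p.1.2, rfl⟩⟩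
      invFun := fun x => ⟨(x.2.1.1, x.2.2.1), by
        rw [x.2.1.2, x.2.2.2]; exact Finset.HasAntidiagonal.mem_antidiagonal.1 x.1.2⟩
      left_inv := fun _ => rfl
      right_inv := by
        rintro ⟨⟨⟨a, b⟩, h⟩, ⟨k, hk⟩, ⟨l, hl⟩⟩
        dsimp only at hk hl
        subst hk hl
        rfl }
  rw [Nat.card_congr e, Nat.card_sigma, Nat.cast_sum,
    ← Finset.sum_coe_sort (Finset.HasAntidiagonal.antidiagonal m)]
  simp [Nat.card_prod]

theorem genSeries_single [DecidableEq S] [Fintype S] :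
    genSeries (fun s : S => Finsupp.single s 1) = ∑ s : S, MvPowerSeries.X s := by
  ext m
  simp only [coeff_genSeries, map_sum, MvPowerSeries.coeff_X]
  rw [Nat.card_eq_fintype_card, Fintype.card_subtype, Finset.sum_boole]
  simp only [eq_comm]

/-- The generating series of the words is inverse to `1 - ∑ tᵢ`. -/
theorem genSeries_wordDegree_mul [DecidableEq S] [Fintype S] :
    genSeries (wordDegree : List S → S →₀ ℕ) * (1 - ∑ s : S, MvPowerSeries.X s) = 1 := by
  have hfin : ∀ m, Finite {w : List S // wordDegree w = m} := finite_wordDegree_fiber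
  have hfin' : ∀ m, Finite {s : S // Finsupp.single s 1 = m} := fun m => inferInstance
  let e : Unit ⊕ S × List S ≃ List S :=
    { toFun := Sum.elim (fun _ => []) fun p => p.1 :: p.2
      invFun := fun w => match w with
        | [] => Sum.inl ()
        | s :: w => Sum.inr (s, w)
      left_inv := by rintro (_ | _) <;> rfl
      right_inv := by rintro (_ | _) <;> rfl }
  have h1 : genSeries (fun _ : Unit => (0 : S →₀ ℕ)) = 1 := by
    ext m
    rw [coeff_genSeries, MvPowerSeries.coeff_one]
    by_cases h : m = 0
    · subst h; simp
    · simp [h, Ne.symm h]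
  have hp := genSeries_prod (fun s : S => Finsupp.single s 1) wordDegree hfin' hfin
  have h : genSeries (wordDegree : List S → S →₀ ℕ) =
      1 + (∑ s : S, MvPowerSeries.X s) * genSeries (wordDegree : List S → S →₀ ℕ) := by
    rw [← genSeries_single, ← hp, ← h1, ← genSeries_sum]
    · exact (genSeries_congr e _ _ (by rintro (_ | _) <;> simp [e])).symm
    · intro m; infer_instance
    · intro m
      refine Finite.of_injective (fun p => (⟨p.1.1 :: p.1.2, by simpa using p.2⟩ :
        {w : List S // wordDegree w = m})) ?_
      rintro ⟨⟨s, w⟩, _⟩ ⟨⟨s', w'⟩, _⟩ h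
      simpa using h
  linear_combination h

end GeneratingSeries

section Homogeneous

variable {F : Type} [Field F] {S : Type} [DecidableEq S]

/-- A subspace of the free algebra is multihomogeneous if it contains the multihomogeneous
components of its elements. -/
def IsMultihomogeneous (I : Submodule F (FreeAlgebra F S)) : Prop :=
  ∀ f ∈ I, ∀ m, (decompose (wordSpan F S) f m : FreeAlgebra F S) ∈ I

theorem decompose_mem_span {κ : Type} {w : κ → FreeAlgebra F S} {D : κ → S →₀ ℕ}
    (hD : ∀ k, w k ∈ wordSpan F S (D k)) {f : FreeAlgebra F S}
    (hf : f ∈ Submodule.span F (Set.range w)) (m : S →₀ ℕ) :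
    (decompose (wordSpan F S) f m : FreeAlgebra F S) ∈
      Submodule.span F (Set.range fun k : {k // D k = m} => w k) := by
  induction hf using Submodule.span_induction with
  | mem x hx =>
    obtain ⟨k, rfl⟩ := hx
    by_cases h : D k = m
    · subst h
      rw [decompose_of_mem_same _ (hD k)]
      exact Submodule.subset_span ⟨⟨k, rfl⟩, rfl⟩
    · rw [decompose_of_mem_ne _ (hD k) h]
      exact zero_mem _
  | zero => simp
  | add x y _ _ hx hy => simpa using add_mem hx hy
  | smul c x _ hx => rw [decompose_smul]; exact Submodule.smul_mem _ c hx

theorem isMultihomogeneous_span {κ : Type} {w : κ → FreeAlgebra F S} {D : κ → S →₀ ℕ}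
    (hD : ∀ k, w k ∈ wordSpan F S (D k)) :
    IsMultihomogeneous (Submodule.span F (Set.range w)) := by
  intro f hf m
  refine Submodule.span_mono ?_ (decompose_mem_span hD hf m)
  rintro _ ⟨k, rfl⟩
  exact ⟨k, rfl⟩

theorem span_range_inf_wordSpan {κ : Type} {w : κ → FreeAlgebra F S} {D : κ → S →₀ ℕ}
    (hD : ∀ k, w k ∈ wordSpan F S (D k)) (m : S →₀ ℕ) :
    Submodule.span F (Set.range w) ⊓ wordSpan F S m =
      Submodule.span F (Set.range fun k : {k // D k = m} => w k) := by
  apply le_antisymm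
  · rintro f ⟨hf, hm⟩
    rw [← decompose_of_mem_same _ hm]
    exact decompose_mem_span hD hf m
  · rw [Submodule.span_le]
    rintro _ ⟨⟨k, rfl⟩, rfl⟩
    exact ⟨Submodule.subset_span ⟨k, rfl⟩, hD k⟩

theorem finite_degree_fiber [Finite S] {κ : Type} {w : κ → FreeAlgebra F S} {D : κ → S →₀ ℕ}
    (hD : ∀ k, w k ∈ wordSpan F S (D k)) (hli : LinearIndependent F w) (m : S →₀ ℕ) :
    Finite {k // D k = m} := by
  have hli' : LinearIndependent F fun k : {k // D k = m} => w k :=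
    hli.comp _ Subtype.val_injective
  have : Module.Finite F
      (Submodule.span F (Set.range fun k : {k // D k = m} => w k)) := by
    rw [← span_range_inf_wordSpan hD]
    exact Submodule.finiteDimensional_inf_right _ _
  exact Module.Finite.finite_basis (Basis.span hli')

/-- The multigraded dimension series of a subspace of the free algebra. -/
noncomputable def dimSeries (I : Submodule F (FreeAlgebra F S)) : MvPowerSeries S ℚ :=
  fun m => (finrank F ↥(I ⊓ wordSpan F S m) : ℚ)

theorem dimSeries_span {κ : Type} {w : κ → FreeAlgebra F S} {D : κ → S →₀ ℕ}
    (hD : ∀ k, w k ∈ wordSpan F S (D k)) (hli : LinearIndependent F w) :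
    dimSeries (Submodule.span F (Set.range w)) = genSeries D := by
  funext m
  have hli' : LinearIndependent F fun k : {k // D k = m} => w k :=
    hli.comp _ Subtype.val_injective
  rw [dimSeries, genSeries, span_range_inf_wordSpan hD,
    finrank_eq_nat_card_basis (Basis.span hli')]

end Homogeneous

section Products

variable {F : Type} [Field F] {S : Type} [DecidableEq S]

/-- A multihomogeneous subspace is spanned, modulo any given subspace, by a family of
multihomogeneous elements that is linearly independent modulo that subspace. -/
theorem exists_multihomogeneous_basis {J : Submodule F (FreeAlgebra F S)}
    (hJ : IsMultihomogeneous J) (N : Submodule F (FreeAlgebra F S)) :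
    ∃ (κ : Type) (w : κ → FreeAlgebra F S) (D : κ → S →₀ ℕ),
      (∀ k, w k ∈ J) ∧ (∀ k, w k ∈ wordSpan F S (D k)) ∧
      LinearIndependent F (fun k => N.mkQ (w k)) ∧ J ≤ Submodule.span F (Set.range w) ⊔ N := by
  obtain ⟨b, hb, -, hspan, hli⟩ := exists_linearIndepOn_extension (K := F) (v := N.mkQ)
    (linearIndepOn_empty F _) (Set.empty_subset {f | f ∈ J ∧ ∃ m, f ∈ wordSpan F S m})
  choose D hD using fun k : b => (hb k.2).2
  refine ⟨b, Subtype.val, D, fun k => (hb k.2).1, hD, hli, fun f hf => ?_⟩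
  classical
  rw [← DirectSum.sum_support_decompose (wordSpan F S) f]
  refine sum_mem fun m _ => ?_
  have := hspan ⟨_, ⟨hJ f hf m, m, SetLike.coe_mem _⟩, rfl⟩
  rw [← Submodule.map_span, SetLike.mem_coe, Submodule.mem_map] at this
  obtain ⟨y, hy, hyx⟩ := this
  rw [Subtype.range_coe]
  rw [Submodule.mkQ_apply, Submodule.mkQ_apply, eq_comm, Submodule.Quotient.eq] at hyx
  exact Submodule.mem_sup.2 ⟨y, hy, _, hyx, by abel⟩

/-- The left ideal generated by a family of multihomogeneous elements which span `J` modulo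
`varMul J` is the whole of `J`. -/
theorem le_top_mul_span {J : Submodule F (FreeAlgebra F S)} (hJ : IsMultihomogeneous J)
    {κ : Type} {w : κ → FreeAlgebra F S} {D : κ → S →₀ ℕ}
    (hD : ∀ k, w k ∈ wordSpan F S (D k))
    (hspan : J ≤ Submodule.span F (Set.range w) ⊔ varMul J) :
    J ≤ ⊤ * Submodule.span F (Set.range w) := by
  have hle : Submodule.span F (Set.range w) ≤ ⊤ * Submodule.span F (Set.range w) := by
    intro x hx
    simpa using Submodule.mul_mem_mul (Submodule.mem_top (x := (1 : FreeAlgebra F S))) hx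
  have hleft : ∀ r, ∀ x ∈ ⊤ * Submodule.span F (Set.range w),
      r * x ∈ ⊤ * Submodule.span F (Set.range w) := by
    intro r x hx
    induction hx using Submodule.mul_induction_on' with
    | mem_mul_mem a ha b hb =>
      rw [← mul_assoc]
      exact Submodule.mul_mem_mul Submodule.mem_top hb
    | add x _ y _ hx hy => rw [mul_add]; exact add_mem hx hy
  have key : ∀ n, ∀ m : S →₀ ℕ, m.degree = n → ∀ f ∈ J, f ∈ wordSpan F S m →
      f ∈ ⊤ * Submodule.span F (Set.range w) := by
    intro n
    induction n using Nat.strong_induction_on with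
    | _ n ih =>
      rintro m rfl f hf hfm
      obtain ⟨y, hy, z, hz, rfl⟩ := Submodule.mem_sup.1 (hspan hf)
      rw [← decompose_of_mem_same _ hfm, decompose_add, DirectSum.add_apply, Submodule.coe_add]
      refine add_mem (hle (isMultihomogeneous_span hD y hy m)) ?_
      clear hfm hf
      induction hz using Submodule.span_induction with
      | mem x hx =>
        obtain ⟨s, g, hg, rfl⟩ := hx
        rw [coe_decompose_mul_of_left_mem _ _ (ι_mem_wordSpan F s)]
        split_ifs with h
        · refine hleft _ _ (ih _ ?_ _ rfl _ (hJ g hg _) (SetLike.coe_mem _))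
          obtain ⟨m', rfl⟩ := exists_add_of_le h
          simp
        · exact zero_mem _
      | zero => simp
      | add x y _ _ hx hy => simpa using add_mem hx hy
      | smul c x _ hx => rw [decompose_smul]; exact Submodule.smul_mem _ c hx
  intro f hf
  classical
  rw [← DirectSum.sum_support_decompose (wordSpan F S) f]
  exact sum_mem fun m _ => key _ m rfl _ (hJ f hf m) (SetLike.coe_mem _)

theorem isMultihomogeneous_top : IsMultihomogeneous (⊤ : Submodule F (FreeAlgebra F S)) :=
  fun _ _ _ => Submodule.mem_top

theorem dimSeries_top :
    dimSeries (⊤ : Submodule F (FreeAlgebra F S)) = genSeries wordDegree := by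
  rw [← (wordBasis F S).span_eq]
  exact dimSeries_span (by simpa using monomial_mem_wordSpan F) (wordBasis F S).linearIndependent

/-- Multiplying a right ideal `I` by a left ideal `J` multiplies the dimension series of `I` by
the generating series of a free homogeneous generating set of `J`. -/
theorem exists_dimSeries_mul [Fintype S] {J : Submodule F (FreeAlgebra F S)}
    (hJ : IsMultihomogeneous J) (hleft : ∀ r, ∀ x ∈ J, r * x ∈ J) :
    ∃ W : MvPowerSeries S ℚ, ∀ I : Submodule F (FreeAlgebra F S), IsMultihomogeneous I →
      I * ⊤ ≤ I → IsMultihomogeneous (I * J) ∧ dimSeries (I * J) = dimSeries I * W := by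
  obtain ⟨κ, w, D, hwJ, hD, hli, hspan⟩ := exists_multihomogeneous_basis hJ (varMul J)
  have hliR := linearIndependent_of_mkQ_varMul hleft hwJ hli
  have hliF : LinearIndependent F w := hli.of_comp (varMul J).mkQ
  have hgen := le_top_mul_span hJ hD hspan
  refine ⟨genSeries D, fun I hI hright => ?_⟩
  obtain ⟨κ', e, D', heI, hD', hli', hspan'⟩ := exists_multihomogeneous_basis hI ⊥
  have hliF' : LinearIndependent F e := hli'.of_comp (Submodule.mkQ ⊥)
  have hIspan : I = Submodule.span F (Set.range e) := by
    refine le_antisymm (by simpa using hspan') (Submodule.span_le.2 ?_)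
    rintro _ ⟨k, rfl⟩
    exact heI k
  have hIJ : I * J = Submodule.span F (Set.range fun p : κ' × κ => e p.1 * w p.2) := by
    have h : I * J = I * Submodule.span F (Set.range w) := by
      apply le_antisymm
      · calc I * J ≤ I * (⊤ * Submodule.span F (Set.range w)) := mul_le_mul_right hgen I
          _ = I * ⊤ * Submodule.span F (Set.range w) := (mul_assoc _ _ _).symm
          _ ≤ _ := mul_le_mul_left hright _
      · refine mul_le_mul_right (Submodule.span_le.2 ?_) I
        rintro _ ⟨k, rfl⟩
        exact hwJ k
    rw [h, hIspan, Submodule.span_mul_span]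
    congr 1
    ext x
    simp [Set.mem_mul]
  have hDp : ∀ p : κ' × κ, e p.1 * w p.2 ∈ wordSpan F S (D' p.1 + D p.2) := fun p =>
    SetLike.mul_mem_graded (hD' p.1) (hD p.2)
  refine ⟨hIJ ▸ isMultihomogeneous_span hDp, ?_⟩
  rw [hIJ, dimSeries_span hDp (linearIndependent_smul hliF' hliR), hIspan,
    dimSeries_span hD' hliF', genSeries_prod _ _ (finite_degree_fiber hD' hliF')
      (finite_degree_fiber hD hliF)]

/-- `H(IJ) = (1 - ∑ tᵢ) H(I) H(J)` for a multihomogeneous right ideal `I` and a multihomogeneous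
left ideal `J` of the free algebra. -/
theorem dimSeries_mul [Fintype S] {I J : Submodule F (FreeAlgebra F S)}
    (hI : IsMultihomogeneous I) (hright : I * ⊤ ≤ I)
    (hJ : IsMultihomogeneous J) (hleft : ∀ r, ∀ x ∈ J, r * x ∈ J) :
    IsMultihomogeneous (I * J) ∧
      dimSeries (I * J) = (1 - ∑ s : S, MvPowerSeries.X s) * dimSeries I * dimSeries J := by
  obtain ⟨W, hW⟩ := exists_dimSeries_mul hJ hleft
  have htop : ⊤ * J = J := by
    apply le_antisymm
    · exact Submodule.mul_le.2 fun r _ x hx => hleft r x hx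
    · intro x hx
      simpa using Submodule.mul_mem_mul (Submodule.mem_top (x := (1 : FreeAlgebra F S))) hx
  have hWJ := (hW ⊤ isMultihomogeneous_top le_top).2
  rw [htop, dimSeries_top] at hWJ
  refine ⟨(hW I hI hright).1, ?_⟩
  rw [(hW I hI hright).2, hWJ]
  linear_combination (-dimSeries I * W) * genSeries_wordDegree_mul (S := S)

theorem dimSeries_pow [Fintype S] {I : Submodule F (FreeAlgebra F S)}
    (hI : IsMultihomogeneous I) (hright : I * ⊤ ≤ I) (hleft : ∀ r, ∀ x ∈ I, r * x ∈ I) (n : ℕ) :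
    IsMultihomogeneous (I ^ (n + 1)) ∧
      dimSeries (I ^ (n + 1)) =
        (1 - ∑ s : S, MvPowerSeries.X s) ^ n * dimSeries I ^ (n + 1) := by
  induction n with
  | zero => simpa using hI
  | succ n ih =>
    have hr : I ^ (n + 1) * ⊤ ≤ I ^ (n + 1) := by
      rw [pow_succ, mul_assoc]
      exact mul_le_mul_right hright _
    rw [pow_succ I]
    obtain ⟨h1, h2⟩ := dimSeries_mul ih.1 hr hI hleft
    refine ⟨h1, ?_⟩
    rw [h2, ih.2]
    ring

theorem gradedSeries_eq_sub [Finite S] (I : Submodule F (FreeAlgebra F S)) :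
    gradedSeries F S I = genSeries wordDegree - dimSeries I := by
  rw [← dimSeries_top (F := F)]
  funext m
  change _ = (_ : ℚ) - _
  simp only [gradedSeries, dimSeries]
  have hI : finrank F ↥(I ⊓ wordSpan F S m) = finrank F (I.comap (wordSpan F S m).subtype) := by
    rw [inf_comm, ← Submodule.map_comap_subtype]
    exact (Submodule.equivMapOfInjective _ (Submodule.subtype_injective _) _).finrank_eq.symm
  rw [eq_sub_iff_add_eq, hI, top_inf_eq, ← Nat.cast_add,
    Submodule.finrank_quotient_add_finrank]

end Products

section Identities

variable {F : Type} [Field F] {A : Type} [Ring A] [Algebra F A]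

theorem map_mem_polyIdeal {S T : Type} (g : FreeAlgebra F S →ₐ[F] FreeAlgebra F T)
    {f : FreeAlgebra F S} (hf : f ∈ polyIdeal F A S) : g f ∈ polyIdeal F A T :=
  fun φ => hf (φ.comp g)

theorem mul_mem_polyIdeal_left {S : Type} (r : FreeAlgebra F S) {f : FreeAlgebra F S}
    (hf : f ∈ polyIdeal F A S) : r * f ∈ polyIdeal F A S := fun φ => by
  rw [map_mul, hf φ, mul_zero]

theorem mul_mem_polyIdeal_right {S : Type} (r : FreeAlgebra F S) {f : FreeAlgebra F S}
    (hf : f ∈ polyIdeal F A S) : f * r ∈ polyIdeal F A S := fun φ => by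
  rw [map_mul, hf φ, zero_mul]

/-- Rescaling the variables multiplies a multihomogeneous polynomial by a scalar monomial. -/
theorem lift_smul_ι_of_mem_wordSpan {S : Type} [Fintype S] [DecidableEq S] (c : S → F)
    {m : S →₀ ℕ} {f : FreeAlgebra F S} (hf : f ∈ wordSpan F S m) :
    FreeAlgebra.lift F (fun s => c s • FreeAlgebra.ι F s) f = (∏ s, c s ^ m s) • f := by
  rw [wordSpan_eq_span_image] at hf
  induction hf using Submodule.span_induction with
  | mem x hx =>
    obtain ⟨w, rfl, rfl⟩ := hx
    induction w with
    | nil => simp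
    | cons s w ih =>
      rw [monomial_cons, map_mul, ih, FreeAlgebra.lift_ι_apply, smul_mul_smul_comm]
      congr 1
      simp only [wordDegree_cons, Finsupp.add_apply, pow_add, Finset.prod_mul_distrib]
      simp [Finsupp.single_apply]
  | zero => simp
  | add x y _ _ hx hy => rw [map_add, hx, hy, smul_add]
  | smul a x _ hx => rw [map_smul, hx, smul_comm]

/-- Over an infinite field the identities of an algebra form a multihomogeneous ideal. -/
theorem isMultihomogeneous_polyIdeal [Infinite F] {S : Type} [Fintype S] [DecidableEq S] :
    IsMultihomogeneous (polyIdeal F A S) := by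
  classical
  intro f hf m φ
  rw [← Module.forall_dual_apply_eq_zero_iff F]
  intro ℓ
  let p : MvPolynomial S F := ∑ k ∈ (decompose (wordSpan F S) f).support,
    MvPolynomial.monomial k (ℓ (φ (decompose (wordSpan F S) f k)))
  have hp : p = 0 := by
    refine MvPolynomial.funext fun c => ?_
    have h := congrArg ℓ (map_mem_polyIdeal (FreeAlgebra.lift F fun s => c s • FreeAlgebra.ι F s)
      hf φ)
    rw [← DirectSum.sum_support_decompose (wordSpan F S) f] at h
    simp only [map_sum, lift_smul_ι_of_mem_wordSpan c (SetLike.coe_mem _), map_smul, map_zero,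
      smul_eq_mul] at h
    rw [map_sum, map_zero, ← h]
    refine Finset.sum_congr rfl fun k _ => ?_
    rw [MvPolynomial.eval_monomial, Finsupp.prod_fintype _ _ fun _ => pow_zero _, mul_comm]
  have := congrArg (MvPolynomial.coeff m) hp
  simp only [p, MvPolynomial.coeff_sum, MvPolynomial.coeff_monomial, Finset.sum_ite_eq',
    MvPolynomial.coeff_zero] at this
  by_cases hm : m ∈ (decompose (wordSpan F S) f).support
  · simpa [hm] using this
  · rw [DFinsupp.notMem_support_iff] at hm
    simp [hm]

/-- If a power relation between the ideals of identities holds in countably many variables, then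
it holds in every set of variables which is a retract of `ℕ`. -/
theorem polyIdeal_eq_pow_of_retract {A₁ : Type} [Ring A₁] [Algebra F A₁] {S : Type} {n : ℕ}
    (p : FreeAlgebra F ℕ →ₐ[F] FreeAlgebra F S) (q : FreeAlgebra F S →ₐ[F] FreeAlgebra F ℕ)
    (hpq : ∀ f, p (q f) = f) (h : polyIdeal F A ℕ = polyIdeal F A₁ ℕ ^ n) :
    polyIdeal F A S = polyIdeal F A₁ S ^ n := by
  have hmap : ∀ {S T : Type} (g : FreeAlgebra F S →ₐ[F] FreeAlgebra F T) {f},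
      f ∈ polyIdeal F A₁ S ^ n → g f ∈ polyIdeal F A₁ T ^ n := by
    intro S T g f hf
    have := Submodule.mem_map_of_mem (f := g.toLinearMap) hf
    rw [Submodule.map_pow] at this
    refine (pow_le_pow_left' (Submodule.map_le_iff_le_comap.2 ?_) n :
      Submodule.map g.toLinearMap (polyIdeal F A₁ S) ^ n ≤ _) this
    exact fun f hf => map_mem_polyIdeal g hf
  ext f
  constructor
  · intro hf
    rw [← hpq f]
    exact hmap p (h ▸ map_mem_polyIdeal q hf)
  · intro hf
    rw [← hpq f]
    exact map_mem_polyIdeal p (h ▸ hmap q hf)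

end Identities

/-- The algebraic identity relating the powers of `q - h` and those of `h` when `q` is inverse
to `u`. -/
theorem sub_pow_eq_sum_choose {R : Type} [CommRing R] {q u h : R} (hq : q * u = 1) (n : ℕ) :
    q - u ^ n * (q - h) ^ (n + 1) =
      ∑ j ∈ Finset.Icc 1 (n + 1), ((n + 1).choose j : R) * (-u) ^ (j - 1) * h ^ j := by
  have hu : IsUnit u := IsUnit.of_mul_eq_one_right q hq
  apply hu.mul_left_cancel
  have h1 : u * (q - u ^ n * (q - h) ^ (n + 1)) = 1 - (1 - u * h) ^ (n + 1) := by
    have : 1 - u * h = u * (q - h) := by linear_combination -hq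
    rw [this, mul_pow]
    linear_combination hq
  have h2 : (1 - u * h) ^ (n + 1) =
      ∑ j ∈ Finset.range (n + 2), (-(u * h)) ^ j * ((n + 1).choose j : R) := by
    rw [sub_eq_neg_add, add_pow]
    simp
  rw [h1, h2, Finset.sum_range_succ', Finset.mul_sum, Finset.range_eq_Ico,
    Finset.sum_Ico_add' (fun j => (-(u * h)) ^ j * ((n + 1).choose j : R)) 0 (n + 1) 1]
  have hI : Finset.Ico (0 + 1) (n + 1 + 1) = Finset.Icc 1 (n + 1) := by ext; simp
  rw [hI]
  simp only [pow_zero, Nat.choose_zero_right, Nat.cast_one, mul_one, sub_add_cancel_right]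
  rw [← Finset.sum_neg_distrib]
  refine Finset.sum_congr rfl fun j hj => ?_
  obtain ⟨k, rfl⟩ := Nat.exists_eq_add_of_le' (Finset.mem_Icc.1 hj).1
  rw [Nat.add_sub_cancel, neg_pow (u * h), mul_pow, neg_pow u]
  ring

end FreeAlgebraHilbert

open FreeAlgebraHilbert

/-- Formanek–Halpin: if `T(A) = T(A₁)ⁿ` then
`H(A; T_d) = ∑_{j=1}^n binom(n,j) (t_1 + ⋯ + t_d - 1)^{j-1} H(A₁; T_d)^j`. -/
theorem hilbertSeries_of_tideal_pow
    (F : Type) [Field F] [CharZero F]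
    (A A₁ : Type) [Ring A] [Algebra F A] [Ring A₁] [Algebra F A₁]
    (hPIA : polyIdeal F A ℕ ≠ ⊥) (hPIA₁ : polyIdeal F A₁ ℕ ≠ ⊥)
    (n : ℕ) (hn : 1 ≤ n)
    (hT : polyIdeal F A ℕ = Submodule.span F
      {x | ∃ g : Fin n → FreeAlgebra F ℕ,
        (∀ i, g i ∈ polyIdeal F A₁ ℕ) ∧ x = (List.ofFn g).prod})
    (d : ℕ) (hd : 1 ≤ d) :
    hilbertSeries F A d =
      ∑ j ∈ Finset.Icc 1 n, (n.choose j : MvPowerSeries (Fin d) ℚ) *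
        (∑ i : Fin d, MvPowerSeries.X i - 1) ^ (j - 1) * hilbertSeries F A₁ d ^ j := by
  obtain ⟨n, rfl⟩ := Nat.exists_eq_add_of_le' hn
  have hpow : polyIdeal F A ℕ = polyIdeal F A₁ ℕ ^ (n + 1) := by
    rw [hT, Submodule.pow_eq_span_pow_set]
    congr 1
    ext x
    rw [Set.mem_pow]
    constructor
    · rintro ⟨g, hg, rfl⟩
      exact ⟨fun i => ⟨g i, hg i⟩, rfl⟩
    · rintro ⟨g, rfl⟩
      exact ⟨fun i => g i, fun i => (g i).2, rfl⟩
  let p : FreeAlgebra F ℕ →ₐ[F] FreeAlgebra F (Fin d) :=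
    FreeAlgebra.lift F fun i => if h : i < d then FreeAlgebra.ι F ⟨i, h⟩ else 0
  let q : FreeAlgebra F (Fin d) →ₐ[F] FreeAlgebra F ℕ :=
    FreeAlgebra.lift F fun i => FreeAlgebra.ι F i
  have hpq : p.comp q = AlgHom.id F _ := by
    ext i
    simp [p, q]
  have hid := polyIdeal_eq_pow_of_retract p q (AlgHom.congr_fun hpq) hpow
  have hright : polyIdeal F A₁ (Fin d) * ⊤ ≤ polyIdeal F A₁ (Fin d) :=
    Submodule.mul_le.2 fun f hf r _ => mul_mem_polyIdeal_right r hf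
  have hdim := (dimSeries_pow isMultihomogeneous_polyIdeal hright
    (fun r _ hx => mul_mem_polyIdeal_left r hx) n).2
  have hA₁ : dimSeries (polyIdeal F A₁ (Fin d)) =
      genSeries wordDegree - hilbertSeries F A₁ d := by
    rw [hilbertSeries, gradedSeries_eq_sub, sub_sub_cancel]
  rw [hilbertSeries, gradedSeries_eq_sub, hid, hdim, hA₁,
    sub_pow_eq_sum_choose genSeries_wordDegree_mul, neg_sub]
end

section
/- Let A_1, A_2 and A be PI-algebras over F such that T(A) = T(A_1) T(A_2). Then for all k, l >= 0, the double Hilbert series satisfy H(A; T_k; Y_l) = H(A_1; T_k; Y_l) + H(A_2; T_k; Y_l) + (t_1 + ... + t_k + y_1 + ... + y_l - 1) * H(A_1; T_k; Y_l) * H(A_2; T_k; Y_l). -/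
/-- The infinite dimensional Grassmann (exterior) algebra over `F`, on the countable
dimensional vector space `ℕ →₀ F`. -/
abbrev Grassmann (F : Type) [Field F] : Type := ExteriorAlgebra F (ℕ →₀ F)

open scoped TensorProduct

/-- The even component of the natural `ℤ/2`-grading of the Grassmann algebra. -/
noncomputable def grassEven (F : Type) [Field F] : Submodule F (Grassmann F) :=
  ⨆ m : ℕ, (LinearMap.range (ExteriorAlgebra.ι F (M := ℕ →₀ F))) ^ (2 * m)

/-- The odd component of the natural `ℤ/2`-grading of the Grassmann algebra. -/
noncomputable def grassOdd (F : Type) [Field F] : Submodule F (Grassmann F) :=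
  ⨆ m : ℕ, (LinearMap.range (ExteriorAlgebra.ι F (M := ℕ →₀ F))) ^ (2 * m + 1)

/-- The even part `A ⊗ E⁽⁰⁾` of `A ⊗ E`. -/
noncomputable def evenPart (F : Type) [Field F] (A : Type) [Ring A] [Algebra F A] :
    Submodule F (A ⊗[F] Grassmann F) :=
  LinearMap.range (TensorProduct.map (LinearMap.id : A →ₗ[F] A) (grassEven F).subtype)

/-- The odd part `A ⊗ E⁽¹⁾` of `A ⊗ E`. -/
noncomputable def oddPart (F : Type) [Field F] (A : Type) [Ring A] [Algebra F A] :
    Submodule F (A ⊗[F] Grassmann F) :=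
  LinearMap.range (TensorProduct.map (LinearMap.id : A →ₗ[F] A) (grassOdd F).subtype)

/-- The `ℤ/2`-graded identities of the magnum `A ⊗ E` of `A` in `k` even free generators
(indexed by `Sum.inl`) and `l` odd free generators (indexed by `Sum.inr`): the elements of the
free algebra vanishing under every homomorphism sending the even generators into the even part
and the odd generators into the odd part of `A ⊗ E`. -/
def t2Ideal (F : Type) [Field F] (A : Type) [Ring A] [Algebra F A] (k l : ℕ) :
    Submodule F (FreeAlgebra F (Fin k ⊕ Fin l)) where
  carrier := {f | ∀ φ : FreeAlgebra F (Fin k ⊕ Fin l) →ₐ[F] (A ⊗[F] Grassmann F),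
      (∀ i : Fin k, φ (FreeAlgebra.ι F (Sum.inl i)) ∈ evenPart F A) →
      (∀ s : Fin l, φ (FreeAlgebra.ι F (Sum.inr s)) ∈ oddPart F A) → φ f = 0}
  add_mem' := by
    intro a b ha hb φ h1 h2
    rw [map_add, ha φ h1 h2, hb φ h1 h2, add_zero]
  zero_mem' := by
    intro φ _ _
    exact map_zero φ
  smul_mem' := by
    intro r a ha φ h1 h2
    rw [map_smul, ha φ h1 h2, smul_zero]

/-- The double Hilbert series `H(A; t_1,…,t_k; y_1,…,y_l)` of `A`: the Hilbert series of the
magnum of `A`, where the variable indexed by `Sum.inl i` is `t_i` and the one indexed by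
`Sum.inr s` is `y_s`. -/
noncomputable def doubleHilbert (F : Type) [Field F] (A : Type) [Ring A] [Algebra F A]
    (k l : ℕ) : MvPowerSeries (Fin k ⊕ Fin l) ℚ :=
  gradedSeries F (Fin k ⊕ Fin l) (t2Ideal F A k l)

namespace FreeAlgebra

section Words

variable (F : Type) [Field F] {S : Type}

/-- The noncommutative monomial of a word. -/
noncomputable def word (w : List S) : FreeAlgebra F S := (w.map (FreeAlgebra.ι F)).prod

@[simp] lemma word_nil : word F ([] : List S) = 1 := by simp [word]

@[simp] lemma word_cons (s : S) (w : List S) : word F (s :: w) = ι F s * word F w := by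
  simp [word]

lemma word_append (v w : List S) : word F (v ++ w) = word F v * word F w := by
  simp [word]

/-- The basis of the free algebra consisting of all words. -/
noncomputable def wordBasis : Module.Basis (List S) F (FreeAlgebra F S) :=
  (basisFreeMonoid F S).reindex FreeMonoid.toList

@[simp] lemma wordBasis_apply (w : List S) : wordBasis F w = word F w := by
  simp only [wordBasis, Module.Basis.reindex_apply, basisFreeMonoid, Module.Basis.map_apply]
  simp [equivMonoidAlgebraFreeMonoid, word, FreeMonoid.lift_apply]

variable {F} in
lemma linearMap_ext_word {M : Type} [AddCommMonoid M] [Module F M]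
    {f g : FreeAlgebra F S →ₗ[F] M} (h : ∀ w, f (word F w) = g (word F w)) : f = g :=
  (wordBasis F).ext fun w => by simpa using h w

variable {F} in
@[elab_as_elim]
lemma word_induction {P : FreeAlgebra F S → Prop} (zero : P 0)
    (add : ∀ x y, P x → P y → P (x + y)) (smul : ∀ (c : F) x, P x → P (c • x))
    (word : ∀ w, P (word F w)) (x : FreeAlgebra F S) : P x := by
  induction (wordBasis F).mem_span x using Submodule.span_induction with
  | mem x h => obtain ⟨w, rfl⟩ := h; simpa using word w
  | zero => exact zero
  | add x y _ _ hx hy => exact add x y hx hy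
  | smul c x _ hx => exact smul c x hx

variable [DecidableEq S]

/-- The multidegree of a word. -/
noncomputable def multidegree (w : List S) : S →₀ ℕ := Multiset.toFinsupp (w : Multiset S)

lemma multidegree_apply (w : List S) (s : S) : multidegree w s = w.count s := by
  simp [multidegree]

@[simp] lemma multidegree_nil : multidegree ([] : List S) = 0 := by
  ext; simp [multidegree_apply]

@[simp] lemma multidegree_cons (s : S) (w : List S) :
    multidegree (s :: w) = multidegree w + Finsupp.single s 1 := by
  ext t; simp [multidegree_apply, List.count_cons, Finsupp.single_apply]

lemma multidegree_append (v w : List S) :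
    multidegree (v ++ w) = multidegree v + multidegree w := by
  ext t; simp [multidegree_apply]

lemma wordSpan_eq (m : S →₀ ℕ) :
    wordSpan F S m = Submodule.span F (word F '' {w | multidegree w = m}) := by
  unfold wordSpan
  congr 1
  ext x
  simp only [Set.mem_ofPred_eq, Set.mem_image, DFunLike.ext_iff, multidegree_apply, word]
  exact ⟨fun ⟨w, h, e⟩ => ⟨w, h, e.symm⟩, fun ⟨w, h, e⟩ => ⟨w, h, e.symm⟩⟩

lemma word_mem_wordSpan (w : List S) : word F w ∈ wordSpan F S (multidegree w) := by
  rw [wordSpan_eq]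
  exact Submodule.subset_span ⟨w, rfl, rfl⟩

lemma mul_mem_wordSpan {p q : S →₀ ℕ} {x y : FreeAlgebra F S}
    (hx : x ∈ wordSpan F S p) (hy : y ∈ wordSpan F S q) : x * y ∈ wordSpan F S (p + q) := by
  rw [wordSpan_eq] at hx hy ⊢
  have := Submodule.mul_mem_mul hx hy
  rw [Submodule.span_mul_span] at this
  refine Submodule.span_mono ?_ this
  rintro _ ⟨_, ⟨v, hv, rfl⟩, _, ⟨w, hw, rfl⟩, rfl⟩
  simp only [Set.mem_ofPred_eq] at hv hw
  exact ⟨v ++ w, by simp [multidegree_append, hv, hw], word_append F v w⟩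

instance [Finite S] (m : S →₀ ℕ) : Module.Finite F (wordSpan F S m) := by
  rw [wordSpan_eq]
  refine Module.Finite.span_of_finite F (Set.Finite.image _ ?_)
  refine (List.finite_length_eq S m.degree).subset ?_
  rintro w rfl
  induction w with
  | nil => simp
  | cons s w ih => simp_all

/-- The projection of the free algebra onto its component of multidegree `m`. -/
noncomputable def gradedProj (m : S →₀ ℕ) : FreeAlgebra F S →ₗ[F] FreeAlgebra F S :=
  (wordBasis F).constr F fun w => if multidegree w = m then word F w else 0

@[simp] lemma gradedProj_word (m : S →₀ ℕ) (w : List S) :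
    gradedProj F m (word F w) = if multidegree w = m then word F w else 0 := by
  rw [gradedProj, ← wordBasis_apply, Module.Basis.constr_basis, wordBasis_apply]

variable {F}

lemma gradedProj_mem (m : S →₀ ℕ) (x : FreeAlgebra F S) :
    gradedProj F m x ∈ wordSpan F S m := by
  induction x using word_induction with
  | zero => simp
  | add x y hx hy => rw [map_add]; exact add_mem hx hy
  | smul c x hx => rw [map_smul]; exact Submodule.smul_mem _ _ hx
  | word w =>
    rw [gradedProj_word]
    split_ifs with h
    · exact h ▸ word_mem_wordSpan F w
    · exact zero_mem _

lemma gradedProj_of_mem {m : S →₀ ℕ} (p : S →₀ ℕ) {x : FreeAlgebra F S}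
    (hx : x ∈ wordSpan F S m) : gradedProj F p x = if m = p then x else 0 := by
  rw [wordSpan_eq] at hx
  induction hx using Submodule.span_induction with
  | mem x h => obtain ⟨w, rfl, rfl⟩ := h; simp
  | zero => simp
  | add x y _ _ hx hy => rw [map_add, hx, hy]; split_ifs <;> simp
  | smul c x _ hx => rw [map_smul, hx]; split_ifs <;> simp

lemma exists_sum_gradedProj (x : FreeAlgebra F S) :
    ∃ s : Finset (S →₀ ℕ), ∀ t, s ⊆ t → ∑ m ∈ t, gradedProj F m x = x := by
  classical
  induction x using word_induction with
  | zero => exact ⟨∅, by simp⟩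
  | add x y hx hy =>
    obtain ⟨s, hs⟩ := hx
    obtain ⟨t, ht⟩ := hy
    refine ⟨s ∪ t, fun u hu => ?_⟩
    simp only [map_add, Finset.sum_add_distrib]
    rw [hs u (Finset.union_subset_left hu), ht u (Finset.union_subset_right hu)]
  | smul c x hx =>
    obtain ⟨s, hs⟩ := hx
    refine ⟨s, fun u hu => ?_⟩
    simp only [map_smul, ← Finset.smul_sum]
    rw [hs u hu]
  | word w =>
    refine ⟨{multidegree w}, fun u hu => ?_⟩
    simp only [gradedProj_word, Finset.sum_ite_eq]
    rw [if_pos (by simpa using hu)]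

lemma mem_of_gradedProj_mem {V : Submodule F (FreeAlgebra F S)} {x : FreeAlgebra F S}
    (h : ∀ m, gradedProj F m x ∈ V) : x ∈ V := by
  obtain ⟨s, hs⟩ := exists_sum_gradedProj x
  rw [← hs s subset_rfl]
  exact sum_mem fun m _ => h m

variable (F) in
/-- The left derivation removing an initial letter `s`. -/
noncomputable def leftDiv (s : S) : FreeAlgebra F S →ₗ[F] FreeAlgebra F S :=
  (wordBasis F).constr F fun w =>
    match w with
    | [] => 0
    | t :: v => if t = s then word F v else 0

@[simp] lemma leftDiv_one (s : S) : leftDiv F s 1 = 0 := by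
  rw [leftDiv, ← word_nil F (S := S), ← wordBasis_apply, Module.Basis.constr_basis]

@[simp] lemma leftDiv_ι_mul (s t : S) (x : FreeAlgebra F S) :
    leftDiv F s (ι F t * x) = if t = s then x else 0 := by
  induction x using word_induction with
  | zero => simp
  | add x y hx hy => rw [mul_add, map_add, hx, hy]; split_ifs <;> simp
  | smul c x hx => rw [mul_smul_comm, map_smul, hx]; split_ifs <;> simp
  | word w =>
    rw [← word_cons, leftDiv, ← wordBasis_apply, Module.Basis.constr_basis]

lemma gradedProj_leftDiv (m : S →₀ ℕ) (s : S) (x : FreeAlgebra F S) :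
    gradedProj F m (leftDiv F s x) = leftDiv F s (gradedProj F (m + Finsupp.single s 1) x) := by
  have : gradedProj F m ∘ₗ leftDiv F s = leftDiv F s ∘ₗ gradedProj F (m + Finsupp.single s 1) := by
    refine linearMap_ext_word fun w => ?_
    cases w with
    | nil =>
      simp only [LinearMap.comp_apply, word_nil, leftDiv_one, map_zero]
      rw [← word_nil, gradedProj_word]
      split_ifs <;> simp
    | cons t w =>
      simp only [LinearMap.comp_apply, gradedProj_word]
      rw [word_cons, leftDiv_ι_mul]
      by_cases h : t = s
      · subst h
        by_cases hw : multidegree w = m <;> simp [hw]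
      · rw [if_neg h, map_zero]
        split_ifs <;> simp [h]
  exact LinearMap.congr_fun this x

lemma leftDiv_mem {m : S →₀ ℕ} {s : S} {x : FreeAlgebra F S}
    (hx : x ∈ wordSpan F S (m + Finsupp.single s 1)) : leftDiv F s x ∈ wordSpan F S m := by
  have := gradedProj_leftDiv m s x
  rw [gradedProj_of_mem _ hx, if_pos rfl] at this
  exact this ▸ gradedProj_mem _ _

lemma leftDiv_eq_zero {m : S →₀ ℕ} {s : S} (h : m s = 0) {x : FreeAlgebra F S}
    (hx : x ∈ wordSpan F S m) : leftDiv F s x = 0 := by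
  have key : ∀ p, gradedProj F p (leftDiv F s x) ∈ (⊥ : Submodule F (FreeAlgebra F S)) := by
    intro p
    rw [gradedProj_leftDiv, gradedProj_of_mem _ hx, if_neg, map_zero]
    · exact zero_mem _
    · rintro rfl
      simp at h
  simpa using mem_of_gradedProj_mem key

lemma eq_add_sum_ι_mul_leftDiv [Fintype S] (x : FreeAlgebra F S) :
    x = algebraMap F _ (algebraMapInv x) + ∑ s, ι F s * leftDiv F s x := by
  have : (LinearMap.id : FreeAlgebra F S →ₗ[F] _) =
      Algebra.linearMap F _ ∘ₗ algebraMapInv.toLinearMap +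
        ∑ s, LinearMap.mulLeft F (ι F s) ∘ₗ leftDiv F s := by
    refine linearMap_ext_word fun w => ?_
    cases w with
    | nil => simp
    | cons t w => simp [algebraMapInv]
  simpa using LinearMap.congr_fun this x

lemma algebraMapInv_of_mem {m : S →₀ ℕ} (h : m ≠ 0) {x : FreeAlgebra F S}
    (hx : x ∈ wordSpan F S m) : algebraMapInv x = 0 := by
  rw [wordSpan_eq] at hx
  induction hx using Submodule.span_induction with
  | mem x h' =>
    obtain ⟨w, rfl, rfl⟩ := h'
    cases w with
    | nil => simp at h
    | cons s w => simp [algebraMapInv]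
  | zero => simp
  | add x y _ _ hx hy => rw [map_add, hx, hy, add_zero]
  | smul c x _ hx => rw [map_smul, hx, smul_zero]

lemma algebraMapInv_gradedProj {x : FreeAlgebra F S} (hx : algebraMapInv x = 0) (m : S →₀ ℕ) :
    algebraMapInv (gradedProj F m x) = 0 := by
  by_cases h : m = 0
  · subst h
    have := exists_sum_gradedProj x
    obtain ⟨s, hs⟩ := this
    have h0 := hs (insert 0 s) (by simp)
    have := congrArg algebraMapInv h0
    rw [map_sum, hx, Finset.sum_eq_single_of_mem 0 (by simp)] at this
    · exact this
    · intro m _ hm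
      exact algebraMapInv_of_mem hm (gradedProj_mem _ _)
  · exact algebraMapInv_of_mem h (gradedProj_mem _ _)

end Words

end FreeAlgebra

namespace FreeAlgebra

open Module

section HilbertCounting

variable {F : Type} [Field F] {S : Type} [DecidableEq S]

/-- The dimension of the component of multidegree `m` of a subspace of the free algebra. -/
noncomputable def homDim (V : Submodule F (FreeAlgebra F S)) (m : S →₀ ℕ) : ℕ :=
  finrank F ↥(V ⊓ wordSpan F S m)

/-- The subspace `V` is multihomogeneous. -/
def IsMultihomogeneous (V : Submodule F (FreeAlgebra F S)) : Prop :=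
  ∀ m, ∀ v ∈ V, gradedProj F m v ∈ V

lemma coeff_gradedSeries [Finite S] (V : Submodule F (FreeAlgebra F S)) (m : S →₀ ℕ) :
    MvPowerSeries.coeff m (gradedSeries F S V) = (homDim (F := F) ⊤ m - homDim V m : ℚ) := by
  have h := Submodule.finrank_quotient_add_finrank (V.comap (wordSpan F S m).subtype)
  have h2 : finrank F ↥(V.comap (wordSpan F S m).subtype) = homDim V m := by
    rw [homDim, inf_comm, ← Submodule.map_comap_subtype]
    exact (LinearEquiv.finrank_eq
      (Submodule.equivMapOfInjective _ (wordSpan F S m).injective_subtype _))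
  rw [h2] at h
  change ((finrank F _ : ℕ) : ℚ) = _
  rw [homDim, top_inf_eq, ← h]
  push_cast
  ring

/-- A linearly independent family of homogeneous elements meets the component of degree `m` of
its span in as many dimensions as it has members of degree `m`. -/
lemma homDim_span_range {J : Type} {b : J → FreeAlgebra F S} (hb : LinearIndependent F b)
    (d : J → S →₀ ℕ) (hd : ∀ j, b j ∈ wordSpan F S (d j)) (m : S →₀ ℕ) [Finite {j // d j = m}] :
    homDim (Submodule.span F (Set.range b)) m = Nat.card {j // d j = m} := by
  have h : Submodule.span F (Set.range b) ⊓ wordSpan F S m =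
      Submodule.span F (Set.range fun j : {j // d j = m} => b j) := by
    apply le_antisymm
    · rintro x ⟨hx, hm⟩
      rw [← show gradedProj F m x = x by rw [gradedProj_of_mem _ hm, if_pos rfl]]
      clear hm
      induction hx using Submodule.span_induction with
      | mem x h =>
        obtain ⟨j, rfl⟩ := h
        rw [gradedProj_of_mem _ (hd j)]
        split_ifs with h
        · exact Submodule.subset_span ⟨⟨j, h⟩, rfl⟩
        · exact zero_mem _
      | zero => simp
      | add x y _ _ hx hy => rw [map_add]; exact add_mem hx hy
      | smul c x _ hx => rw [map_smul]; exact Submodule.smul_mem _ _ hx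
    · rw [Submodule.span_le]
      rintro _ ⟨⟨j, rfl⟩, rfl⟩
      exact ⟨Submodule.subset_span ⟨j, rfl⟩, hd j⟩
  have := Fintype.ofFinite {j // d j = m}
  rw [homDim, h, Nat.card_eq_fintype_card]
  exact finrank_span_eq_card (hb.comp (fun j : {j // d j = m} => j.1) Subtype.val_injective)

section HomFamily

variable (G : (S →₀ ℕ) → Submodule F (FreeAlgebra F S)) [∀ m, Module.Finite F (G m)]

/-- The family of homogeneous elements obtained by choosing a basis of every `G m`. -/
noncomputable def homFamily (j : Σ m, Fin (finrank F (G m))) : FreeAlgebra F S :=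
  (finBasis F (G j.1) j.2 : FreeAlgebra F S)

omit [DecidableEq S] in
lemma homFamily_mem (j : Σ m, Fin (finrank F (G m))) : homFamily G j ∈ G j.1 :=
  Subtype.property _

variable {G}

omit [DecidableEq S] in
lemma le_span_homFamily (m : S →₀ ℕ) : G m ≤ Submodule.span F (Set.range (homFamily G)) := by
  intro v hv
  have h : _ = v := congrArg Subtype.val ((finBasis F (G m)).sum_repr ⟨v, hv⟩)
  rw [← h]
  simp only [Submodule.coe_sum, Submodule.coe_smul]
  exact sum_mem fun i _ => Submodule.smul_mem _ _ (Submodule.subset_span ⟨⟨m, i⟩, rfl⟩)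

/-- If the `G m` meet a multihomogeneous subspace `K` trivially, then the union of their bases is
linearly independent modulo `K`. -/
lemma homFamily_linearCombination_mem (hG : ∀ m, G m ≤ wordSpan F S m)
    {K : Submodule F (FreeAlgebra F S)} (hK : IsMultihomogeneous K) (hGK : ∀ m, Disjoint (G m) K)
    {l : (Σ m, Fin (finrank F (G m))) →₀ F}
    (hl : Finsupp.linearCombination F (homFamily G) l ∈ K) : l = 0 := by
  have key : ∀ m (l : (Σ m, Fin (finrank F (G m))) →₀ F),
      gradedProj F m (Finsupp.linearCombination F (homFamily G) l) =
      ∑ i, l ⟨m, i⟩ • (finBasis F (G m) i : FreeAlgebra F S) := by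
    intro m l
    induction l using Finsupp.induction_linear with
    | zero => simp
    | add f g hf hg => simp [add_smul, Finset.sum_add_distrib, hf, hg]
    | single j a =>
      obtain ⟨p, i⟩ := j
      rw [Finsupp.linearCombination_single, map_smul,
        gradedProj_of_mem _ (hG _ (homFamily_mem G ⟨p, i⟩))]
      by_cases h : p = m
      · subst h
        rw [if_pos rfl, Finset.sum_eq_single i]
        · simp [homFamily]
        · intro k _ hk
          rw [Finsupp.single_eq_of_ne, zero_smul]
          simpa using hk
        · simp
      · rw [if_neg h, smul_zero, Finset.sum_eq_zero]
        intro k _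
        rw [Finsupp.single_eq_of_ne, zero_smul]
        rintro ⟨⟩
        exact h rfl
  ext ⟨m, i⟩
  have h1 : ∑ i, l ⟨m, i⟩ • finBasis F (G m) i = 0 := by
    apply Subtype.ext
    have h2 : ((∑ i, l ⟨m, i⟩ • finBasis F (G m) i : G m) : FreeAlgebra F S) ∈ K := by
      simp only [Submodule.coe_sum, Submodule.coe_smul]
      rw [← key]
      exact hK m _ hl
    exact (Submodule.disjoint_def.1 (hGK m)) _ (Subtype.property _) h2
  exact Fintype.linearIndependent_iff.1 (finBasis F (G m)).linearIndependent _ h1 i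

end HomFamily

lemma IsMultihomogeneous.exists_basis [Finite S] {V : Submodule F (FreeAlgebra F S)}
    (hV : IsMultihomogeneous V) :
    ∃ b : (Σ m, Fin (finrank F ↥(V ⊓ wordSpan F S m))) → FreeAlgebra F S, LinearIndependent F b ∧
      (∀ j, b j ∈ wordSpan F S j.1) ∧ Submodule.span F (Set.range b) = V := by
  have (m : S →₀ ℕ) : Module.Finite F ↥(V ⊓ wordSpan F S m) :=
    Submodule.finiteDimensional_of_le inf_le_right
  refine ⟨homFamily fun m => V ⊓ wordSpan F S m, ?_, fun j => (homFamily_mem _ j).2, ?_⟩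
  · rw [linearIndependent_iff]
    intro l hl
    refine homFamily_linearCombination_mem (fun m => inf_le_right) (K := ⊥) ?_
      (fun m => disjoint_bot_right) hl
    rintro m _ rfl
    simp
  · apply le_antisymm
    · rw [Submodule.span_le]
      rintro _ ⟨j, rfl⟩
      exact (homFamily_mem _ j).1
    · intro v hv
      refine mem_of_gradedProj_mem fun m => ?_
      exact le_span_homFamily (G := fun m => V ⊓ wordSpan F S m) m
        ⟨hV m v hv, gradedProj_mem m v⟩

/-- The subspace `∑ s, x_s V`, for a left ideal `V`. -/
noncomputable def augMul (V : Submodule F (FreeAlgebra F S)) : Submodule F (FreeAlgebra F S) :=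
  LinearMap.ker (algebraMapInv (R := F) (X := S)).toLinearMap ⊓ ⨅ s, V.comap (leftDiv F s)

lemma mem_augMul {V : Submodule F (FreeAlgebra F S)} {x : FreeAlgebra F S} :
    x ∈ augMul V ↔ algebraMapInv x = 0 ∧ ∀ s, leftDiv F s x ∈ V := by
  simp [augMul]

lemma sum_ι_mul_mem_augMul [Fintype S] {V : Submodule F (FreeAlgebra F S)}
    {y : S → FreeAlgebra F S} (hy : ∀ s, y s ∈ V) : ∑ s, ι F s * y s ∈ augMul V := by
  rw [mem_augMul]
  refine ⟨by simp [algebraMapInv], fun s => ?_⟩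
  simpa [map_sum] using hy s

lemma IsMultihomogeneous.augMul {V : Submodule F (FreeAlgebra F S)}
    (hV : IsMultihomogeneous V) : IsMultihomogeneous (augMul V) := by
  intro m x hx
  rw [mem_augMul] at hx ⊢
  refine ⟨algebraMapInv_gradedProj hx.1 m, fun s => ?_⟩
  by_cases h : m s = 0
  · rw [leftDiv_eq_zero h (gradedProj_mem m x)]
    exact zero_mem _
  · obtain ⟨p, rfl⟩ : ∃ p, m = p + Finsupp.single s 1 :=
      ⟨m - Finsupp.single s 1, by
        rw [tsub_add_cancel_of_le]; simpa [Nat.one_le_iff_ne_zero] using h⟩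
    rw [← gradedProj_leftDiv]
    exact hV _ _ (hx.2 s)

lemma augMul_le [Fintype S] {V : Submodule F (FreeAlgebra F S)}
    (hl : ∀ r, ∀ v ∈ V, r * v ∈ V) : augMul V ≤ V := by
  intro x hx
  rw [mem_augMul] at hx
  rw [eq_add_sum_ι_mul_leftDiv x, hx.1, map_zero, zero_add]
  exact sum_mem fun s _ => hl _ _ (hx.2 s)

lemma homDim_augMul [Fintype S] (V : Submodule F (FreeAlgebra F S)) (m : S →₀ ℕ) :
    homDim (augMul V) m =
      ∑ s, if Finsupp.single s 1 ≤ m then homDim V (m - Finsupp.single s 1) else 0 := by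
  let Z : S → Submodule F (FreeAlgebra F S) := fun s =>
    if Finsupp.single s 1 ≤ m then V ⊓ wordSpan F S (m - Finsupp.single s 1) else ⊥
  have (s : S) : Module.Finite F (Z s) := by
    by_cases h : Finsupp.single s 1 ≤ m
    · have hs : Z s = V ⊓ wordSpan F S (m - Finsupp.single s 1) := if_pos h
      rw [hs]
      exact Submodule.finiteDimensional_of_le inf_le_right
    · have hs : Z s = ⊥ := if_neg h
      rw [hs]
      infer_instance
  have hZ1 : ∀ x ∈ augMul V ⊓ wordSpan F S m, ∀ s, leftDiv F s x ∈ Z s := by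
    intro x hx s
    simp only [Z]
    split_ifs with h
    · refine ⟨(mem_augMul.1 hx.1).2 s, leftDiv_mem ?_⟩
      rw [tsub_add_cancel_of_le h]
      exact hx.2
    · rw [Submodule.mem_bot]
      refine leftDiv_eq_zero (m := m) ?_ hx.2
      simpa using h
  have hZ2 : ∀ y : Π s, Z s, ∑ s, ι F s * (y s : FreeAlgebra F S) ∈
      augMul V ⊓ wordSpan F S m := by
    intro y
    constructor
    · refine sum_ι_mul_mem_augMul fun s => ?_
      have := (y s).2
      simp only [Z] at this
      split_ifs at this
      · exact this.1
      · rw [(Submodule.mem_bot _).1 this]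
        exact zero_mem _
    · refine sum_mem fun s _ => ?_
      have := (y s).2
      simp only [Z] at this
      split_ifs at this with h
      · have h2 := mul_mem_wordSpan F (word_mem_wordSpan F [s]) this.2
        simpa [add_tsub_cancel_of_le h] using h2
      · rw [(Submodule.mem_bot _).1 this, mul_zero]
        exact zero_mem _
  let e : ↥(augMul V ⊓ wordSpan F S m) ≃ₗ[F] Π s, Z s :=
    { toFun := fun x s => ⟨leftDiv F s x, hZ1 x x.2 s⟩
      map_add' := by intro x y; ext s; simp
      map_smul' := by intro c x; ext s; simp
      invFun := fun y => ⟨_, hZ2 y⟩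
      left_inv := by
        intro x
        ext
        conv_rhs => rw [eq_add_sum_ι_mul_leftDiv x.1, (mem_augMul.1 x.2.1).1, map_zero, zero_add]
      right_inv := by
        intro y
        ext s
        simp [map_sum] }
  rw [homDim, e.finrank_eq, Module.finrank_pi_fintype]
  refine Finset.sum_congr rfl fun s _ => ?_
  by_cases h : Finsupp.single s 1 ≤ m
  · have hs : Z s = V ⊓ wordSpan F S (m - Finsupp.single s 1) := if_pos h
    rw [hs, if_pos h, homDim]
  · have hs : Z s = ⊥ := if_neg h
    rw [hs, if_neg h, finrank_bot]

end HilbertCounting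
end FreeAlgebra

namespace FreeAlgebra

open Module

section FreeLeftIdeals

variable {F : Type} [Field F] {S : Type} [DecidableEq S]

lemma wordBasis_coord_word (v w : List S) :
    (wordBasis F).coord v (word F w) = if w = v then 1 else 0 := by
  rw [← wordBasis_apply, Module.Basis.coord_apply, Module.Basis.repr_self, Finsupp.single_apply]

lemma wordBasis_coord_nil (x : FreeAlgebra F S) :
    (wordBasis F).coord [] x = algebraMapInv x := by
  have : (wordBasis F).coord [] = (algebraMapInv (R := F) (X := S)).toLinearMap := by
    refine linearMap_ext_word fun w => ?_
    rw [wordBasis_coord_word]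
    cases w with
    | nil => simp
    | cons t w => simp [algebraMapInv]
  exact LinearMap.congr_fun this x

lemma wordBasis_coord_leftDiv (s : S) (w : List S) (x : FreeAlgebra F S) :
    (wordBasis F).coord w (leftDiv F s x) = (wordBasis F).coord (s :: w) x := by
  have : (wordBasis F).coord w ∘ₗ leftDiv F s = (wordBasis F).coord (s :: w) := by
    refine linearMap_ext_word fun v => ?_
    cases v with
    | nil =>
      rw [LinearMap.comp_apply, wordBasis_coord_word, word_nil, leftDiv_one, map_zero]
      simp
    | cons t v =>
      rw [LinearMap.comp_apply, wordBasis_coord_word, word_cons, leftDiv_ι_mul]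
      by_cases h : t = s
      · simp only [h, if_true, wordBasis_coord_word, List.cons.injEq, true_and]
      · simp [h]
  exact LinearMap.congr_fun this x

/-- A homogeneous complement of `∑ s, x_s V` in a left ideal `V`. -/
lemma exists_compl_augMul [Fintype S] {V : Submodule F (FreeAlgebra F S)}
    (hl : ∀ r, ∀ v ∈ V, r * v ∈ V) :
    ∃ G : (S →₀ ℕ) → Submodule F (FreeAlgebra F S), (∀ m, G m ≤ V ⊓ wordSpan F S m) ∧
      (∀ m, Disjoint (G m) (augMul V)) ∧ (∀ m, V ⊓ wordSpan F S m ≤ G m ⊔ augMul V) ∧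
      ∀ m, finrank F (G m) + homDim (augMul V) m = homDim V m := by
  have key : ∀ m, ∃ C : Submodule F (FreeAlgebra F S), C ≤ V ⊓ wordSpan F S m ∧
      Disjoint C (augMul V) ∧ V ⊓ wordSpan F S m ≤ C ⊔ augMul V ∧
      finrank F C + homDim (augMul V) m = homDim V m := by
    intro m
    have : Module.Finite F ↥(V ⊓ wordSpan F S m) :=
      Submodule.finiteDimensional_of_le inf_le_right
    have : Module.Finite F ↥(augMul V ⊓ wordSpan F S m) :=
      Submodule.finiteDimensional_of_le inf_le_right
    obtain ⟨C, hC⟩ := exists_isCompl (augMul V ⊓ wordSpan F S m)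
    have hle : augMul V ⊓ wordSpan F S m ≤ V ⊓ wordSpan F S m :=
      inf_le_inf_right _ (augMul_le hl)
    have hsup : C ⊓ (V ⊓ wordSpan F S m) ⊔ (augMul V ⊓ wordSpan F S m) =
        V ⊓ wordSpan F S m := by
      rw [sup_comm, ← sup_inf_assoc_of_le C hle, hC.sup_eq_top, top_inf_eq]
    have hinf : C ⊓ (V ⊓ wordSpan F S m) ⊓ (augMul V ⊓ wordSpan F S m) = ⊥ := by
      rw [eq_bot_iff, ← hC.inf_eq_bot, inf_comm (augMul V ⊓ wordSpan F S m)]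
      exact inf_le_inf_right _ inf_le_left
    have : Module.Finite F ↥(C ⊓ (V ⊓ wordSpan F S m)) :=
      Submodule.finiteDimensional_of_le inf_le_right
    refine ⟨C ⊓ (V ⊓ wordSpan F S m), inf_le_right, ?_, ?_, ?_⟩
    · rw [disjoint_iff, eq_bot_iff, ← hinf]
      exact le_inf inf_le_left (le_inf inf_le_right (inf_le_left.trans
        (inf_le_right.trans inf_le_right)))
    · conv_lhs => rw [← hsup]
      exact sup_le_sup_left inf_le_left _
    · have h := Submodule.finrank_sup_add_finrank_inf_eq (C ⊓ (V ⊓ wordSpan F S m))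
        (augMul V ⊓ wordSpan F S m)
      rw [hsup, hinf, finrank_bot, add_zero] at h
      exact h.symm
  choose G h1 h2 h3 h4 using key
  exact ⟨G, h1, h2, h3, h4⟩

/-- Homogeneous elements of a left ideal `V` that are independent modulo `∑ s, x_s V` are left
linearly independent over the free algebra. -/
lemma linearIndependent_homFamily [Fintype S] {V : Submodule F (FreeAlgebra F S)}
    (hV : IsMultihomogeneous V) (hl : ∀ r, ∀ v ∈ V, r * v ∈ V)
    {G : (S →₀ ℕ) → Submodule F (FreeAlgebra F S)} [∀ m, Module.Finite F (G m)]
    (hG : ∀ m, G m ≤ V ⊓ wordSpan F S m) (hd : ∀ m, Disjoint (G m) (augMul V)) :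
    LinearIndependent (FreeAlgebra F S) (homFamily G) := by
  rw [linearIndependent_iff']
  intro t g hg i hi
  have key : ∀ (w : List S) (g : (Σ m, Fin (finrank F (G m))) → FreeAlgebra F S),
      ∑ i ∈ t, g i * homFamily G i = 0 → ∀ i ∈ t, (wordBasis F).coord w (g i) = 0 := by
    intro w
    have step : ∀ g : (Σ m, Fin (finrank F (G m))) → FreeAlgebra F S,
        ∑ i ∈ t, g i * homFamily G i = 0 → ∀ i ∈ t, algebraMapInv (g i) = 0 := by
      intro g hg
      let l : (Σ m, Fin (finrank F (G m))) →₀ F :=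
        ∑ i ∈ t, Finsupp.single i (algebraMapInv (g i))
      have h0 : ∑ s, ι F s * ∑ i ∈ t, leftDiv F s (g i) * homFamily G i ∈ augMul V :=
        sum_ι_mul_mem_augMul fun s => sum_mem fun i _ =>
          hl _ _ (hG _ (homFamily_mem G i)).1
      have h1 : Finsupp.linearCombination F (homFamily G) l =
          - ∑ s, ι F s * ∑ i ∈ t, leftDiv F s (g i) * homFamily G i := by
        rw [eq_neg_iff_add_eq_zero, ← hg]
        simp only [l, map_sum, Finsupp.linearCombination_single, Finset.mul_sum]
        rw [Finset.sum_comm, ← Finset.sum_add_distrib]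
        refine Finset.sum_congr rfl fun i _ => ?_
        conv_rhs => rw [eq_add_sum_ι_mul_leftDiv (g i)]
        simp only [add_mul, Finset.sum_mul, mul_assoc, Algebra.smul_def]
      have h2 : l = 0 := by
        refine homFamily_linearCombination_mem (fun m => (hG m).trans inf_le_right) hV.augMul hd ?_
        rw [h1]
        exact neg_mem h0
      intro i hi
      have h3 := DFunLike.congr_fun h2 i
      simpa [l, Finsupp.finsetSum_apply, Finsupp.single_apply, hi] using h3
    induction w with
    | nil =>
      intro g hg i hi
      rw [wordBasis_coord_nil]
      exact step g hg i hi
    | cons s w ih =>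
      intro g hg i hi
      rw [← wordBasis_coord_leftDiv]
      refine ih (fun i => leftDiv F s (g i)) ?_ i hi
      have h := congrArg (leftDiv F s) hg
      rw [map_sum, map_zero] at h
      rw [← h]
      refine Finset.sum_congr rfl fun i hi => ?_
      conv_rhs => rw [eq_add_sum_ι_mul_leftDiv (g i), step g hg i hi]
      simp [Finset.sum_mul, mul_assoc, map_sum]
  apply (wordBasis F).repr.injective
  ext w
  simpa using key w g hg i hi

lemma mem_span_homFamily [Fintype S] {V : Submodule F (FreeAlgebra F S)}
    (hV : IsMultihomogeneous V)
    {G : (S →₀ ℕ) → Submodule F (FreeAlgebra F S)} [∀ m, Module.Finite F (G m)]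
    (hG : ∀ m, G m ≤ V ⊓ wordSpan F S m) (hs : ∀ m, V ⊓ wordSpan F S m ≤ G m ⊔ augMul V)
    {v : FreeAlgebra F S} (hv : v ∈ V) :
    v ∈ Submodule.span (FreeAlgebra F S) (Set.range (homFamily G)) := by
  have key : ∀ n (m : S →₀ ℕ), m.degree = n → ∀ v ∈ V ⊓ wordSpan F S m,
      v ∈ Submodule.span (FreeAlgebra F S) (Set.range (homFamily G)) := by
    intro n
    induction n using Nat.strong_induction_on with
    | h n ih =>
    intro m hm v hv
    obtain ⟨g, hg, k, hk, rfl⟩ := Submodule.mem_sup.1 (hs m hv)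
    have hkm : k ∈ wordSpan F S m := by
      simpa using sub_mem hv.2 (hG m hg).2
    refine add_mem ?_ ?_
    · have h := le_span_homFamily (G := G) m hg
      exact Submodule.span_le_restrictScalars F (FreeAlgebra F S) _ h
    · rw [mem_augMul] at hk
      rw [eq_add_sum_ι_mul_leftDiv k, hk.1, map_zero, zero_add]
      refine sum_mem fun s _ => Submodule.smul_mem _ (ι F s) ?_
      by_cases h : m s = 0
      · rw [leftDiv_eq_zero h hkm]
        exact zero_mem _
      · obtain ⟨p, rfl⟩ : ∃ p, m = p + Finsupp.single s 1 :=
          ⟨m - Finsupp.single s 1, by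
            rw [tsub_add_cancel_of_le]; simpa [Nat.one_le_iff_ne_zero] using h⟩
        refine ih p.degree ?_ p rfl _ ⟨hk.2 s, leftDiv_mem hkm⟩
        rw [← hm]
        simp
  obtain ⟨s, h⟩ := exists_sum_gradedProj v
  rw [← h s subset_rfl]
  exact sum_mem fun m _ => key _ m rfl _ ⟨hV m v hv, gradedProj_mem m v⟩

lemma card_graded_prod (a g : (S →₀ ℕ) → ℕ) (m : S →₀ ℕ) :
    Finite {x : (Σ p, Fin (a p)) × (Σ q, Fin (g q)) // x.1.1 + x.2.1 = m} ∧
    Nat.card {x : (Σ p, Fin (a p)) × (Σ q, Fin (g q)) // x.1.1 + x.2.1 = m} =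
      ∑ x ∈ Finset.HasAntidiagonal.antidiagonal m, a x.1 * g x.2 := by
  let e : {x : (Σ p, Fin (a p)) × (Σ q, Fin (g q)) // x.1.1 + x.2.1 = m} ≃
      Σ x : Finset.HasAntidiagonal.antidiagonal m, Fin (a x.1.1) × Fin (g x.1.2) :=
    { toFun := fun x => ⟨⟨(x.1.1.1, x.1.2.1), by simpa using x.2⟩, (x.1.1.2, x.1.2.2)⟩
      invFun := fun y => ⟨(⟨y.1.1.1, y.2.1⟩, ⟨y.1.1.2, y.2.2⟩), Finset.HasAntidiagonal.mem_antidiagonal.1 y.1.2⟩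
      left_inv := fun x => rfl
      right_inv := fun y => rfl }
  refine ⟨Finite.of_equiv _ e.symm, ?_⟩
  rw [Nat.card_congr e, Nat.card_sigma]
  simp only [Nat.card_prod, Nat.card_fin]
  exact Finset.sum_coe_sort (Finset.HasAntidiagonal.antidiagonal m) (fun x => a x.1 * g x.2)

lemma exists_homDim_mul [Fintype S] {V₁ V₂ : Submodule F (FreeAlgebra F S)}
    (hV₁ : IsMultihomogeneous V₁) (hr : ∀ r, ∀ v ∈ V₁, v * r ∈ V₁)
    (hV₂ : IsMultihomogeneous V₂) (hl : ∀ r, ∀ v ∈ V₂, r * v ∈ V₂) :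
    ∃ g : (S →₀ ℕ) → ℕ, (∀ m, g m + homDim (augMul V₂) m = homDim V₂ m) ∧
      ∀ m, homDim (V₁ * V₂) m = ∑ x ∈ Finset.HasAntidiagonal.antidiagonal m, homDim V₁ x.1 * g x.2 := by
  obtain ⟨G, hG, hd, hs, hg⟩ := exists_compl_augMul hl
  have (m : S →₀ ℕ) : Module.Finite F (G m) :=
    Submodule.finiteDimensional_of_le ((hG m).trans inf_le_right)
  obtain ⟨b, hb, hbd, hbs⟩ := hV₁.exists_basis
  refine ⟨_, hg, fun m => ?_⟩
  have hc := linearIndependent_homFamily hV₂ hl hG hd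
  have hind := linearIndependent_smul hb hc
  have hspan : Submodule.span F (Set.range fun p : (Σ m, Fin (finrank F ↥(V₁ ⊓ wordSpan F S m))) ×
      (Σ m, Fin (finrank F (G m))) => b p.1 • homFamily G p.2) = V₁ * V₂ := by
    apply le_antisymm
    · rw [Submodule.span_le]
      rintro _ ⟨p, rfl⟩
      refine Submodule.mul_mem_mul ?_ (hG _ (homFamily_mem G p.2)).1
      exact hbs.le (Submodule.subset_span ⟨_, rfl⟩)
    · rw [Submodule.mul_le]
      intro x hx v hv
      replace hv := mem_span_homFamily hV₂ hG hs hv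
      induction hv using Submodule.span_induction generalizing x with
      | mem v h =>
        obtain ⟨i, rfl⟩ := h
        rw [← hbs] at hx
        induction hx using Submodule.span_induction with
        | mem x h =>
          obtain ⟨j, rfl⟩ := h
          exact Submodule.subset_span ⟨(j, i), rfl⟩
        | zero => simp
        | add x y _ _ hx hy => rw [add_mul]; exact add_mem hx hy
        | smul c x _ hx => rw [smul_mul_assoc]; exact Submodule.smul_mem _ _ hx
      | zero => simp
      | add v w _ _ hv hw => rw [mul_add]; exact add_mem (hv x hx) (hw x hx)
      | smul r v _ hv => rw [smul_eq_mul, ← mul_assoc]; exact hv _ (hr _ _ hx)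
  obtain ⟨hfin, hcard⟩ := card_graded_prod (fun p => finrank F ↥(V₁ ⊓ wordSpan F S p))
    (fun q => finrank F (G q)) m
  rw [← hspan, homDim_span_range hind (fun p => p.1.1 + p.2.1), hcard]
  · rfl
  · intro p
    exact mul_mem_wordSpan F (hbd p.1) (hG _ (homFamily_mem G p.2)).2

end FreeLeftIdeals

end FreeAlgebra

namespace FreeAlgebra

open Module

section HilbertSeriesMul

variable {F : Type} [Field F] {S : Type} [DecidableEq S]

/-- The Hilbert series of a subspace of the free algebra. -/
noncomputable def homSeries (V : Submodule F (FreeAlgebra F S)) : MvPowerSeries S ℚ :=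
  fun m => (homDim V m : ℚ)

lemma coeff_homSeries (V : Submodule F (FreeAlgebra F S)) (m : S →₀ ℕ) :
    MvPowerSeries.coeff m (homSeries V) = (homDim V m : ℚ) := rfl

lemma gradedSeries_eq [Finite S] (V : Submodule F (FreeAlgebra F S)) :
    gradedSeries F S V = homSeries (F := F) ⊤ - homSeries V := by
  ext m
  rw [coeff_gradedSeries, map_sub, coeff_homSeries, coeff_homSeries]

lemma homSeries_augMul [Fintype S] (V : Submodule F (FreeAlgebra F S)) :
    homSeries (augMul V) = (∑ s, MvPowerSeries.X s) * homSeries V := by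
  ext m
  rw [coeff_homSeries, homDim_augMul, Finset.sum_mul, map_sum]
  push_cast
  refine Finset.sum_congr rfl fun s _ => ?_
  rw [MvPowerSeries.X_def, MvPowerSeries.coeff_monomial_mul]
  split_ifs <;> simp [coeff_homSeries]

lemma homSeries_mul [Fintype S] {V₁ V₂ : Submodule F (FreeAlgebra F S)}
    (hV₁ : IsMultihomogeneous V₁) (hr : ∀ r, ∀ v ∈ V₁, v * r ∈ V₁)
    (hV₂ : IsMultihomogeneous V₂) (hl : ∀ r, ∀ v ∈ V₂, r * v ∈ V₂) :
    homSeries (V₁ * V₂) =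
      homSeries V₁ * ((1 - ∑ s, MvPowerSeries.X s) * homSeries V₂) := by
  obtain ⟨g, hg, h⟩ := exists_homDim_mul hV₁ hr hV₂ hl
  obtain ⟨γ, hγ⟩ : ∃ γ : MvPowerSeries S ℚ, ∀ m, MvPowerSeries.coeff m γ = (g m : ℚ) :=
    ⟨fun m => (g m : ℚ), fun m => rfl⟩
  have hG : (1 - ∑ s, MvPowerSeries.X s) * homSeries V₂ = γ := by
    rw [sub_mul, one_mul, ← homSeries_augMul]
    ext m
    rw [map_sub, coeff_homSeries, coeff_homSeries, ← hg m, hγ]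
    push_cast
    ring
  rw [hG]
  ext m
  rw [coeff_homSeries, h m, MvPowerSeries.coeff_mul]
  push_cast
  exact Finset.sum_congr rfl fun x _ => by rw [coeff_homSeries, hγ]

lemma homSeries_top [Fintype S] :
    (1 - ∑ s, MvPowerSeries.X s) * homSeries (⊤ : Submodule F (FreeAlgebra F S)) = 1 := by
  rw [sub_mul, one_mul, ← homSeries_augMul]
  ext m
  rw [map_sub, coeff_homSeries, coeff_homSeries, MvPowerSeries.coeff_one]
  split_ifs with h
  · subst h
    rw [homDim_augMul, Finset.sum_eq_zero]
    · have h1 : (⊤ : Submodule F (FreeAlgebra F S)) ⊓ wordSpan F S 0 = Submodule.span F {1} := by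
        rw [top_inf_eq, wordSpan_eq]
        congr 1
        ext x
        simp only [Set.mem_image, Set.mem_ofPred_eq, Set.mem_singleton_iff]
        constructor
        · rintro ⟨w, hw, rfl⟩
          cases w with
          | nil => simp
          | cons s w => simp at hw
        · rintro rfl
          exact ⟨[], by simp⟩
      rw [homDim, h1, finrank_span_singleton one_ne_zero]
      simp
    · intro s _
      rw [if_neg]
      simp
  · have h1 : (⊤ : Submodule F (FreeAlgebra F S)) ⊓ wordSpan F S m =
        augMul ⊤ ⊓ wordSpan F S m := by
      refine le_antisymm (fun x hx => ⟨?_, hx.2⟩) (inf_le_inf_right _ le_top)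
      rw [SetLike.mem_coe, mem_augMul]
      exact ⟨algebraMapInv_of_mem h hx.2, fun s => trivial⟩
    rw [homDim, homDim, h1, sub_self]

/-- The Hilbert series of the quotient by a product of multihomogeneous ideals of the free
algebra. -/
theorem gradedSeries_mul [Fintype S] {U V₁ V₂ : Submodule F (FreeAlgebra F S)}
    (hV₁ : IsMultihomogeneous V₁) (hr : ∀ r, ∀ v ∈ V₁, v * r ∈ V₁)
    (hV₂ : IsMultihomogeneous V₂) (hl : ∀ r, ∀ v ∈ V₂, r * v ∈ V₂)
    (hU : ∀ m, U ⊓ wordSpan F S m = V₁ * V₂ ⊓ wordSpan F S m) :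
    gradedSeries F S U = gradedSeries F S V₁ + gradedSeries F S V₂ +
      (∑ s, MvPowerSeries.X s - 1) * gradedSeries F S V₁ * gradedSeries F S V₂ := by
  have h : homSeries U = homSeries (V₁ * V₂) := by
    ext m
    rw [coeff_homSeries, coeff_homSeries, homDim, homDim, hU]
  have h1 := homSeries_top (F := F) (S := S)
  simp only [gradedSeries_eq]
  rw [h, homSeries_mul hV₁ hr hV₂ hl]
  generalize homSeries (⊤ : Submodule F (FreeAlgebra F S)) = T at *
  linear_combination (T - homSeries V₁ - homSeries V₂) * h1

end HilbertSeriesMul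

end FreeAlgebra

namespace TensorProduct

open Module

section Slice

variable {F : Type} [Field F] {M N : Type} [AddCommGroup M] [Module F M] [AddCommGroup N]
  [Module F N]

/-- Contraction of the right tensor factor with a linear functional. -/
noncomputable def slice (ξ : N →ₗ[F] F) : M ⊗[F] N →ₗ[F] M :=
  (TensorProduct.rid F M).toLinearMap ∘ₗ LinearMap.lTensor M ξ

@[simp] lemma slice_tmul (ξ : N →ₗ[F] F) (x : M) (y : N) : slice ξ (x ⊗ₜ[F] y) = ξ y • x := by
  simp [slice]

lemma slice_map {M' : Type} [AddCommGroup M'] [Module F M'] (f : M →ₗ[F] M') (ξ : N →ₗ[F] F)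
    (y : M ⊗[F] N) : slice ξ (TensorProduct.map f LinearMap.id y) = f (slice ξ y) := by
  induction y with
  | zero => simp
  | tmul x y => simp
  | add x y hx hy => simp only [map_add, hx, hy]

/-- The tensors all of whose contractions lie in `V`. -/
noncomputable def sliceSubmodule (V : Submodule F M) (N : Type) [AddCommGroup N] [Module F N] :
    Submodule F (M ⊗[F] N) :=
  ⨅ ξ : N →ₗ[F] F, V.comap (slice ξ)

lemma mem_sliceSubmodule {V : Submodule F M} {y : M ⊗[F] N} :
    y ∈ sliceSubmodule V N ↔ ∀ ξ : N →ₗ[F] F, slice ξ y ∈ V := by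
  simp [sliceSubmodule]

lemma tmul_mem_sliceSubmodule {V : Submodule F M} {x : M} (hx : x ∈ V) (y : N) :
    x ⊗ₜ[F] y ∈ sliceSubmodule V N := by
  rw [mem_sliceSubmodule]
  intro ξ
  rw [slice_tmul]
  exact V.smul_mem _ hx

/-- If the coordinates of `y` with respect to a basis of the right factor lie in `V`, then `y` is
a sum of pure tensors with left components in `V`. -/
lemma mem_span_of_slice_coord_mem {ι : Type} (b : Basis ι F N) {V : Submodule F M}
    {y : M ⊗[F] N} (h : ∀ i, slice (b.coord i) y ∈ V) :
    y ∈ Submodule.span F {z | ∃ v ∈ V, ∃ n : N, z = v ⊗ₜ[F] n} := by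
  classical
  rw [← (equivFinsuppOfBasisRight (M := M) b).symm_apply_apply y,
    equivFinsuppOfBasisRight_symm_apply]
  refine sum_mem fun i _ => Submodule.subset_span ⟨_, ?_, _, rfl⟩
  rw [equivFinsuppOfBasisRight_apply]
  exact h i

lemma mem_span_of_mem_sliceSubmodule {V : Submodule F M} {y : M ⊗[F] N}
    (h : y ∈ sliceSubmodule V N) :
    y ∈ Submodule.span F {z | ∃ v ∈ V, ∃ n : N, z = v ⊗ₜ[F] n} :=
  mem_span_of_slice_coord_mem (Basis.ofVectorSpace F N) fun _ => mem_sliceSubmodule.1 h _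

lemma eq_zero_of_slice_coord {ι : Type} (b : Basis ι F N) {y : M ⊗[F] N}
    (h : ∀ i, slice (b.coord i) y = 0) : y = 0 := by
  have := mem_span_of_slice_coord_mem (V := ⊥) b (y := y) (by simpa using h)
  have hle : Submodule.span F {z : M ⊗[F] N | ∃ v ∈ (⊥ : Submodule F M), ∃ n : N, z = v ⊗ₜ[F] n}
      ≤ ⊥ := by
    rw [Submodule.span_le]
    rintro _ ⟨v, hv, n, rfl⟩
    simp [(Submodule.mem_bot F).1 hv]
  exact (Submodule.mem_bot F).1 (hle this)

lemma exists_slice_ne_zero {y : M ⊗[F] N} (hy : y ≠ 0) :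
    ∃ (ξ : N →ₗ[F] F) (η : M →ₗ[F] F), η (slice ξ y) ≠ 0 := by
  by_contra! h
  refine hy (eq_zero_of_slice_coord (Basis.ofVectorSpace F N) fun i => ?_)
  exact (Module.forall_dual_apply_eq_zero_iff F _).1 fun η => h _ η

lemma mul_mem_sliceSubmodule {R C : Type} [Ring R] [Algebra F R] [Ring C] [Algebra F C]
    {V W : Submodule F R} {x y : R ⊗[F] C} (hx : x ∈ sliceSubmodule V C)
    (hy : y ∈ sliceSubmodule W C) : x * y ∈ sliceSubmodule (V * W) C := by
  have h := Submodule.mul_mem_mul (mem_span_of_mem_sliceSubmodule hx)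
    (mem_span_of_mem_sliceSubmodule hy)
  rw [Submodule.span_mul_span] at h
  refine Submodule.span_le.2 ?_ h
  rintro _ ⟨_, ⟨v, hv, a, rfl⟩, _, ⟨w, hw, b, rfl⟩, rfl⟩
  simp only [Algebra.TensorProduct.tmul_mul_tmul]
  exact tmul_mem_sliceSubmodule (Submodule.mul_mem_mul hv hw) _

/-- Contraction with a character, as an algebra homomorphism. -/
noncomputable def sliceHom {R C : Type} [Ring R] [Algebra F R] [Ring C] [Algebra F C]
    (χ : C →ₐ[F] F) : R ⊗[F] C →ₐ[F] R :=
  (Algebra.TensorProduct.rid F F R).toAlgHom.comp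
    (Algebra.TensorProduct.map (AlgHom.id F R) χ)

lemma sliceHom_tmul {R C : Type} [Ring R] [Algebra F R] [Ring C] [Algebra F C]
    (χ : C →ₐ[F] F) (x : R) (c : C) : sliceHom χ (x ⊗ₜ[F] c) = χ c • x := by
  simp [sliceHom]

lemma sliceHom_apply {R C : Type} [Ring R] [Algebra F R] [Ring C] [Algebra F C]
    (χ : C →ₐ[F] F) (y : R ⊗[F] C) : sliceHom χ y = slice χ.toLinearMap y := by
  induction y with
  | zero => simp
  | tmul x c => rw [sliceHom_tmul, slice_tmul, AlgHom.toLinearMap_apply]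
  | add x y hx hy => rw [map_add, map_add, hx, hy]

/-- A tensor with polynomial coefficients all of whose specializations lie in `V` has its
coefficients in `V`. -/
lemma slice_lcoeff_mem [Infinite F] {σ : Type} {V : Submodule F M}
    {y : M ⊗[F] MvPolynomial σ F}
    (h : ∀ a : σ → F, slice (MvPolynomial.aeval a).toLinearMap y ∈ V) (m : σ →₀ ℕ) :
    slice (MvPolynomial.lcoeff F m) y ∈ V := by
  by_contra hm
  obtain ⟨η, hη, hV⟩ := Submodule.exists_le_ker_of_notMem hm
  have hcomm : ∀ ξ : MvPolynomial σ F →ₗ[F] F,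
      η (slice ξ y) = ξ (TensorProduct.lid F _ (η.rTensor _ y)) := by
    intro ξ
    clear h hm hη
    induction y with
    | zero => simp
    | tmul x c => simp [mul_comm]
    | add x y hx hy => simp only [map_add, hx, hy]
  have hp : TensorProduct.lid F _ (η.rTensor _ y) = 0 := by
    refine MvPolynomial.funext fun a => ?_
    have h1 := hcomm (MvPolynomial.aeval a).toLinearMap
    rw [show η _ = 0 from hV (h a)] at h1
    rw [map_zero, h1]
    simp [MvPolynomial.aeval_eq_eval]
  apply hη
  rw [hcomm, hp, map_zero]

end Slice

end TensorProduct

section ScalarExtension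

variable {F : Type} [Field F] [Infinite F] {A C : Type} [Ring A] [Algebra F A] [CommRing C]
  [Algebra F C]

/-- Polynomial identities over an infinite field are stable under commutative scalar extension. -/
lemma map_eq_zero_of_mem_polyIdeal {S : Type} {f : FreeAlgebra F S} (hf : f ∈ polyIdeal F A S)
    (φ : FreeAlgebra F S →ₐ[F] A ⊗[F] C) : φ f = 0 := by
  let π : MvPolynomial C F →ₐ[F] C := MvPolynomial.aeval id
  have hπ : Function.Surjective π := fun c => ⟨MvPolynomial.X c, by simp [π]⟩
  have hmap : Function.Surjective (Algebra.TensorProduct.map (AlgHom.id F A) π) :=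
    TensorProduct.map_surjective Function.surjective_id hπ
  choose y hy using fun s => hmap (φ (FreeAlgebra.ι F s))
  have hφ : φ = (Algebra.TensorProduct.map (AlgHom.id F A) π).comp (FreeAlgebra.lift F y) := by
    ext s
    simp [hy]
  have h0 : FreeAlgebra.lift F y f = 0 := by
    refine TensorProduct.eq_zero_of_slice_coord (MvPolynomial.basisMonomials C F) fun m => ?_
    have h := TensorProduct.slice_lcoeff_mem (V := ⊥) (y := FreeAlgebra.lift F y f) ?_ m
    · exact h
    · intro a
      rw [← TensorProduct.sliceHom_apply, Submodule.mem_bot]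
      exact hf ((TensorProduct.sliceHom (MvPolynomial.aeval a)).comp (FreeAlgebra.lift F y))
  rw [hφ, AlgHom.comp_apply, h0, map_zero]

end ScalarExtension

namespace FreeAlgebra

section Multihomogeneous

variable {F : Type} [Field F] {S : Type} [DecidableEq S]

/-- The homomorphism `x_s ↦ x_s ⊗ t_s` recording multidegrees. -/
noncomputable def degreeHom (F : Type) [Field F] (S : Type) :
    FreeAlgebra F S →ₐ[F] FreeAlgebra F S ⊗[F] MvPolynomial S F :=
  lift F fun s => ι F s ⊗ₜ[F] MvPolynomial.X s

lemma degreeHom_word (w : List S) :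
    degreeHom F S (word F w) = word F w ⊗ₜ[F] MvPolynomial.monomial (multidegree w) 1 := by
  induction w with
  | nil => simp [Algebra.TensorProduct.one_def]
  | cons s w ih =>
    rw [word_cons, map_mul, ih, degreeHom, lift_ι_apply, Algebra.TensorProduct.tmul_mul_tmul,
      MvPolynomial.X, MvPolynomial.monomial_mul, multidegree_cons, mul_one, add_comm]

lemma slice_lcoeff_degreeHom (m : S →₀ ℕ) (x : FreeAlgebra F S) :
    TensorProduct.slice (MvPolynomial.lcoeff F m) (degreeHom F S x) = gradedProj F m x := by
  induction x using word_induction with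
  | zero => simp
  | add x y hx hy => simp only [map_add, hx, hy]
  | smul c x hx => simp only [map_smul, hx]
  | word w =>
    rw [degreeHom_word, TensorProduct.slice_tmul, gradedProj_word, MvPolynomial.lcoeff_apply,
      MvPolynomial.coeff_monomial]
    split_ifs <;> simp

/-- A subspace stable under rescaling the generators is multihomogeneous. -/
lemma isMultihomogeneous_of_scaling [Infinite F] {V : Submodule F (FreeAlgebra F S)}
    (hV : ∀ (a : S → F), ∀ v ∈ V, lift F (fun s => a s • ι F s) v ∈ V) :
    IsMultihomogeneous V := by
  intro m v hv
  rw [← slice_lcoeff_degreeHom]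
  refine TensorProduct.slice_lcoeff_mem (fun a => ?_) m
  rw [← TensorProduct.sliceHom_apply]
  have h : (TensorProduct.sliceHom (MvPolynomial.aeval a)).comp (degreeHom F S) =
      lift F (fun s => a s • ι F s) := by
    ext s
    simp [degreeHom, TensorProduct.sliceHom_tmul]
  have := hV a v hv
  rwa [← h] at this

end Multihomogeneous

end FreeAlgebra

section GradedIdentities

variable (F : Type) [Field F] (A : Type) [Ring A] [Algebra F A]

/-- The homogeneous component of the Grassmann algebra in which the generator `s` takes its
values. -/
noncomputable def parityPart (k l : ℕ) : Fin k ⊕ Fin l → Submodule F (Grassmann F) :=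
  Sum.elim (fun _ => grassEven F) (fun _ => grassOdd F)

/-- Homomorphisms to `A ⊗ E` respecting the grading. -/
def IsGradedHom {k l : ℕ} (φ : FreeAlgebra F (Fin k ⊕ Fin l) →ₐ[F] A ⊗[F] Grassmann F) : Prop :=
  ∀ s, φ (FreeAlgebra.ι F s) ∈
    LinearMap.range (TensorProduct.map (LinearMap.id : A →ₗ[F] A) (parityPart F k l s).subtype)

variable {F A} {k l : ℕ}

lemma mem_t2Ideal {f : FreeAlgebra F (Fin k ⊕ Fin l)} :
    f ∈ t2Ideal F A k l ↔ ∀ φ, IsGradedHom F A φ → φ f = 0 :=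
  ⟨fun h φ hφ => h φ (fun i => hφ (Sum.inl i)) (fun s => hφ (Sum.inr s)),
    fun h φ h1 h2 => h φ (Sum.rec h1 h2)⟩

lemma mul_mem_t2Ideal_left (r : FreeAlgebra F (Fin k ⊕ Fin l)) :
    ∀ v ∈ t2Ideal F A k l, r * v ∈ t2Ideal F A k l := by
  intro v hv
  rw [mem_t2Ideal] at hv ⊢
  intro φ hφ
  rw [map_mul, hv φ hφ, mul_zero]

lemma mul_mem_t2Ideal_right (r : FreeAlgebra F (Fin k ⊕ Fin l)) :
    ∀ v ∈ t2Ideal F A k l, v * r ∈ t2Ideal F A k l := by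
  intro v hv
  rw [mem_t2Ideal] at hv ⊢
  intro φ hφ
  rw [map_mul, hv φ hφ, zero_mul]

lemma isMultihomogeneous_t2Ideal [Infinite F] :
    FreeAlgebra.IsMultihomogeneous (t2Ideal F A k l) := by
  refine FreeAlgebra.isMultihomogeneous_of_scaling fun a v hv => ?_
  rw [mem_t2Ideal] at hv ⊢
  intro φ hφ
  refine hv (φ.comp _) fun s => ?_
  rw [AlgHom.comp_apply, FreeAlgebra.lift_ι_apply, map_smul]
  exact Submodule.smul_mem _ _ (hφ s)

end GradedIdentities

section GrassmannAlgebra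

open scoped IsMulCommutative

variable {F : Type} [Field F]

lemma Grassmann.ι_mul_of_mem_pow {n : ℕ} {x : Grassmann F}
    (hx : x ∈ (LinearMap.range (ExteriorAlgebra.ι F (M := ℕ →₀ F))) ^ n) (v : ℕ →₀ F) :
    ExteriorAlgebra.ι F v * x = (-1 : F) ^ n • (x * ExteriorAlgebra.ι F v) := by
  induction hx using Submodule.pow_induction_on_left' with
  | algebraMap r => rw [pow_zero, one_smul, Algebra.commutes]
  | add x y i _ _ hx hy => rw [mul_add, add_mul, smul_add, hx, hy]
  | mem_mul m hm i x _ hx =>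
    obtain ⟨w, rfl⟩ := hm
    rw [← mul_assoc, eq_neg_of_add_eq_zero_left (ExteriorAlgebra.ι_add_mul_swap v w), neg_mul,
      mul_assoc, hx, mul_smul_comm, pow_succ, mul_neg_one, neg_smul, mul_assoc]

lemma Grassmann.mul_comm_of_mem_even {x : Grassmann F} (hx : x ∈ grassEven F)
    (y : Grassmann F) : y * x = x * y := by
  have key : ∀ v, ExteriorAlgebra.ι F v * x = x * ExteriorAlgebra.ι F v := by
    intro v
    unfold grassEven at hx
    induction hx using Submodule.iSup_induction' with
    | mem i x hx => simpa [pow_mul] using ι_mul_of_mem_pow hx v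
    | zero => simp
    | add x y _ _ hx hy => rw [mul_add, add_mul, hx, hy]
  induction y using ExteriorAlgebra.induction with
  | algebraMap r => exact Algebra.commutes r x
  | ι v => exact key v
  | mul a b ha hb => rw [mul_assoc, hb, ← mul_assoc, ha, mul_assoc]
  | add a b ha hb => rw [add_mul, mul_add, ha, hb]

lemma Grassmann.mul_anticomm_of_mem_odd {x y : Grassmann F} (hx : x ∈ grassOdd F)
    (hy : y ∈ grassOdd F) : y * x = - (x * y) := by
  have key : ∀ v, ExteriorAlgebra.ι F v * x = - (x * ExteriorAlgebra.ι F v) := by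
    intro v
    unfold grassOdd at hx
    induction hx using Submodule.iSup_induction' with
    | mem i x hx => simpa [pow_mul, pow_succ] using ι_mul_of_mem_pow hx v
    | zero => simp
    | add x y _ _ hx hy => rw [mul_add, add_mul, hx, hy, neg_add]
  have key2 : ∀ (n : ℕ) (y : Grassmann F),
      y ∈ (LinearMap.range (ExteriorAlgebra.ι F (M := ℕ →₀ F))) ^ n →
      y * x = (-1 : F) ^ n • (x * y) := by
    intro n y hy
    induction hy using Submodule.pow_induction_on_left' with
    | algebraMap r => rw [pow_zero, one_smul, Algebra.commutes]
    | add x y i _ _ hx hy => rw [mul_add, add_mul, smul_add, hx, hy]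
    | mem_mul m hm i y _ hy =>
      obtain ⟨w, rfl⟩ := hm
      rw [mul_assoc, hy, mul_smul_comm, ← mul_assoc, key, pow_succ, mul_neg_one, neg_smul,
        neg_mul, smul_neg, mul_assoc]
  unfold grassOdd at hy
  induction hy using Submodule.iSup_induction' with
  | mem i y hy => simpa [pow_mul, pow_succ] using key2 _ y hy
  | zero => simp
  | add a b _ _ ha hb => rw [mul_add, add_mul, ha, hb, neg_add]

variable (F) in
/-- The pure tensors in `E ⊗ E` with components of the same parity. -/
def diagonalTensors : Set (Grassmann F ⊗[F] Grassmann F) :=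
  {z | (∃ x ∈ grassEven F, ∃ y ∈ grassEven F, z = x ⊗ₜ[F] y) ∨
    ∃ x ∈ grassOdd F, ∃ y ∈ grassOdd F, z = x ⊗ₜ[F] y}

lemma diagonalTensors_comm : ∀ x ∈ diagonalTensors F, ∀ y ∈ diagonalTensors F,
    x * y = y * x := by
  rintro _ (⟨a, ha, b, hb, rfl⟩ | ⟨a, ha, b, hb, rfl⟩) _
    (⟨c, hc, d, hd, rfl⟩ | ⟨c, hc, d, hd, rfl⟩) <;>
  simp only [Algebra.TensorProduct.tmul_mul_tmul]
  · rw [Grassmann.mul_comm_of_mem_even ha c, Grassmann.mul_comm_of_mem_even hb d]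
  · rw [Grassmann.mul_comm_of_mem_even ha c, Grassmann.mul_comm_of_mem_even hb d]
  · rw [Grassmann.mul_comm_of_mem_even hc a, Grassmann.mul_comm_of_mem_even hd b]
  · rw [Grassmann.mul_anticomm_of_mem_odd ha hc, Grassmann.mul_anticomm_of_mem_odd hb hd,
      TensorProduct.neg_tmul, TensorProduct.tmul_neg, neg_neg]

variable (F) in
/-- The even part of the twisted product of two Grassmann algebras is commutative. -/
lemma exists_commRing_diagonalTensors :
    ∃ (C : Type) (_ : CommRing C) (_ : Algebra F C)
      (i : C →ₐ[F] Grassmann F ⊗[F] Grassmann F),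
      Function.Injective i ∧ ∀ z ∈ diagonalTensors F, ∃ c, i c = z := by
  have := Algebra.isMulCommutative_adjoin F (diagonalTensors_comm (F := F))
  exact ⟨Algebra.adjoin F (diagonalTensors F), inferInstance, inferInstance,
    (Algebra.adjoin F (diagonalTensors F)).val, Subtype.val_injective,
    fun z hz => ⟨⟨z, Algebra.subset_adjoin hz⟩, rfl⟩⟩

lemma Grassmann.list_prod_ne_zero {L : List ℕ} (hL : L.Nodup) :
    (L.map fun n => ExteriorAlgebra.ι F (Finsupp.single n (1 : F))).prod ≠ 0 := by
  induction L with
  | nil => simp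
  | cons n L ih =>
    rw [List.nodup_cons] at hL
    let d : Module.Dual F (ℕ →₀ F) := Finsupp.lapply n
    have hd : ∀ L : List ℕ, n ∉ L → CliffordAlgebra.contractLeft (Q := (0 : QuadraticForm F _)) d
        (L.map fun n => ExteriorAlgebra.ι F (Finsupp.single n (1 : F))).prod = 0 := by
      intro L hn
      induction L with
      | nil => simp
      | cons k L ih =>
        rw [List.mem_cons, not_or] at hn
        rw [List.map_cons, List.prod_cons, CliffordAlgebra.contractLeft_ι_mul, ih hn.2, mul_zero,
          sub_zero]
        simp [d, Ne.symm hn.1]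
    intro h
    apply ih hL.2
    have h2 := congrArg (CliffordAlgebra.contractLeft (Q := (0 : QuadraticForm F _)) d) h
    rw [List.map_cons, List.prod_cons, CliffordAlgebra.contractLeft_ι_mul, hd L hL.1, mul_zero,
      sub_zero, map_zero] at h2
    simpa [d] using h2

end GrassmannAlgebra

section SquareZero

variable {C : Type} [CommRing C]

lemma sum_mul_prod_eq_zero_of_sq_eq_zero {J : Type} {y : J → C} (hy : ∀ j, y j * y j = 0)
    (s : Finset J) : (∑ j ∈ s, y j) * ∏ j ∈ s, y j = 0 := by
  classical
  rw [Finset.sum_mul]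
  refine Finset.sum_eq_zero fun j hj => ?_
  rw [← Finset.mul_prod_erase s y hj, ← mul_assoc, hy, zero_mul]

/-- The top power of a sum of commuting elements of square zero. -/
lemma sum_pow_card_of_sq_eq_zero {J : Type} {y : J → C} (hy : ∀ j, y j * y j = 0)
    (s : Finset J) : (∑ j ∈ s, y j) ^ s.card = s.card.factorial * ∏ j ∈ s, y j := by
  classical
  have hpow : ∀ (a z : C), a * a = 0 → ∀ n : ℕ,
      (a + z) ^ (n + 1) = z ^ (n + 1) + (n + 1) * (a * z ^ n) := by
    intro a z ha n
    induction n with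
    | zero => ring
    | succ n ih =>
      rw [pow_succ, ih]
      push_cast
      linear_combination ((n : C) + 1) * z ^ n * ha
  induction s using Finset.induction_on with
  | empty => simp
  | insert j s hj ih =>
    rw [Finset.sum_insert hj, Finset.prod_insert hj, Finset.card_insert_of_notMem hj,
      hpow _ _ (hy j), pow_succ, ih, mul_assoc, mul_comm (∏ j ∈ s, y j),
      sum_mul_prod_eq_zero_of_sq_eq_zero hy, Nat.factorial_succ]
    push_cast
    ring

end SquareZero

section Transfer

open TensorProduct (slice sliceSubmodule)

lemma TensorProduct.slice_slice {F M N P : Type} [Field F] [AddCommGroup M] [Module F M]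
    [AddCommGroup N] [Module F N] [AddCommGroup P] [Module F P] (ξ : P →ₗ[F] F) (η : N →ₗ[F] F)
    (x : (M ⊗[F] N) ⊗[F] P) :
    slice η (slice ξ x) = slice (η ∘ₗ slice ξ) (TensorProduct.assoc F M N P x) := by
  induction x with
  | zero => simp
  | tmul x p =>
    induction x with
    | zero => simp
    | tmul a b => simp [smul_smul]
    | add x y hx hy => simp only [TensorProduct.add_tmul, map_add, hx, hy]
  | add x y hx hy => simp only [map_add, hx, hy]

variable (F : Type) [Field F] {k l : ℕ}

/-- The Grassmann coefficients: `1` for the even generators and pairwise distinct generators of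
`E` for the odd ones. -/
noncomputable def grassCoeff : (Fin k ⊕ Fin l) × ℕ → Grassmann F
  | (Sum.inl _, _) => 1
  | (Sum.inr s, j) => ExteriorAlgebra.ι F (Finsupp.single (Encodable.encode (s, j)) 1)

lemma grassCoeff_mem (q : (Fin k ⊕ Fin l) × ℕ) : grassCoeff F q ∈ parityPart F k l q.1 := by
  obtain ⟨i | s, j⟩ := q
  · refine Submodule.mem_iSup_of_mem 0 ?_
    rw [mul_zero, pow_zero]
    exact Submodule.one_le.1 le_rfl
  · refine Submodule.mem_iSup_of_mem 0 ?_
    rw [mul_zero, zero_add, pow_one]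
    exact ⟨_, rfl⟩

variable {F} in
lemma tmul_mem_diagonalTensors {s : Fin k ⊕ Fin l} {x y : Grassmann F}
    (hx : x ∈ parityPart F k l s) (hy : y ∈ parityPart F k l s) :
    x ⊗ₜ[F] y ∈ diagonalTensors F := by
  cases s with
  | inl i => exact Or.inl ⟨x, hx, y, hy, rfl⟩
  | inr s => exact Or.inr ⟨x, hx, y, hy, rfl⟩

/-- The substitution `x_s ↦ ∑ j < m s, x_{s,j} ⊗ h_{s,j}`, whose coefficients are the graded
multilinearizations in multidegree `m`. -/
noncomputable def polarize (m : Fin k ⊕ Fin l →₀ ℕ) :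
    FreeAlgebra F (Fin k ⊕ Fin l) →ₐ[F] FreeAlgebra F ℕ ⊗[F] Grassmann F :=
  FreeAlgebra.lift F fun s => ∑ j ∈ Finset.range (m s),
    FreeAlgebra.ι F (Encodable.encode (s, j)) ⊗ₜ[F] grassCoeff F (s, j)

variable (k l) in
/-- The substitution `x_{s,j} ↦ x_s ⊗ h_{s,j}`. -/
noncomputable def restitute :
    FreeAlgebra F ℕ →ₐ[F] FreeAlgebra F (Fin k ⊕ Fin l) ⊗[F] Grassmann F :=
  FreeAlgebra.lift F fun n => (Encodable.decode n : Option ((Fin k ⊕ Fin l) × ℕ)).elim 0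
    fun q => FreeAlgebra.ι F q.1 ⊗ₜ[F] grassCoeff F q

variable {F} {A : Type} [Ring A] [Algebra F A]

lemma polarize_mem (m : Fin k ⊕ Fin l →₀ ℕ) {f : FreeAlgebra F (Fin k ⊕ Fin l)}
    (hf : f ∈ t2Ideal F A k l) :
    polarize F m f ∈ sliceSubmodule (polyIdeal F A ℕ) (Grassmann F) := by
  rw [TensorProduct.mem_sliceSubmodule]
  intro ξ θ
  have h := mem_t2Ideal.1 hf
    ((Algebra.TensorProduct.map θ (AlgHom.id F (Grassmann F))).comp (polarize F m)) (by
      intro s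
      rw [AlgHom.comp_apply, polarize, FreeAlgebra.lift_ι_apply, map_sum]
      refine sum_mem fun j _ => ?_
      exact ⟨θ (FreeAlgebra.ι F (Encodable.encode (s, j))) ⊗ₜ[F]
        ⟨grassCoeff F (s, j), grassCoeff_mem F (s, j)⟩, by simp⟩)
  have h2 := TensorProduct.slice_map θ.toLinearMap ξ (polarize F m f)
  rw [AlgHom.toLinearMap_apply] at h2
  rw [← h2]
  have h3 : TensorProduct.map θ.toLinearMap LinearMap.id (polarize F m f) = 0 := h
  rw [h3, map_zero]

lemma restitute_mem [Infinite F] {g : FreeAlgebra F ℕ} (hg : g ∈ polyIdeal F A ℕ) :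
    restitute F k l g ∈ sliceSubmodule (t2Ideal F A k l) (Grassmann F) := by
  rw [TensorProduct.mem_sliceSubmodule]
  intro η
  rw [mem_t2Ideal]
  intro φ hφ
  obtain ⟨C, _, _, i, hi, hC⟩ := exists_commRing_diagonalTensors F
  let Ω : FreeAlgebra F ℕ →ₐ[F] A ⊗[F] (Grassmann F ⊗[F] Grassmann F) :=
    (Algebra.TensorProduct.assoc F F F A (Grassmann F) (Grassmann F)).toAlgHom.comp
      ((Algebra.TensorProduct.map φ (AlgHom.id F (Grassmann F))).comp (restitute F k l))
  have hrange : ∀ n, ∃ z : A ⊗[F] C, Algebra.TensorProduct.map (AlgHom.id F A) i z =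
      Ω (FreeAlgebra.ι F n) := by
    intro n
    change Ω (FreeAlgebra.ι F n) ∈ (Algebra.TensorProduct.map (AlgHom.id F A) i).range
    simp only [Ω, AlgHom.comp_apply, restitute, FreeAlgebra.lift_ι_apply]
    cases (Encodable.decode n : Option ((Fin k ⊕ Fin l) × ℕ)) with
    | none =>
      simp only [Option.elim_none, map_zero]
      exact zero_mem _
    | some q =>
      simp only [Option.elim_some, Algebra.TensorProduct.map_tmul]
      obtain ⟨y, hy⟩ := hφ q.1
      rw [← hy]
      clear hy
      induction y with
      | zero =>
        simp only [map_zero, TensorProduct.zero_tmul]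
        exact zero_mem _
      | tmul a e =>
        obtain ⟨c, hc⟩ := hC _ (tmul_mem_diagonalTensors e.2 (grassCoeff_mem F q))
        exact ⟨a ⊗ₜ c, by simp [hc]⟩
      | add x y hx hy =>
        simp only [map_add, TensorProduct.add_tmul]
        exact add_mem hx hy
  choose z hz using hrange
  have hΩ : Ω = (Algebra.TensorProduct.map (AlgHom.id F A) i).comp (FreeAlgebra.lift F z) := by
    ext n
    simp [hz]
  have h0 : Ω g = 0 := by
    rw [hΩ, AlgHom.comp_apply, map_eq_zero_of_mem_polyIdeal hg, map_zero]
  have h1 : Algebra.TensorProduct.map φ (AlgHom.id F (Grassmann F)) (restitute F k l g) = 0 := by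
    apply (Algebra.TensorProduct.assoc F F F A (Grassmann F) (Grassmann F)).injective
    rw [map_zero]
    exact h0
  have h2 := TensorProduct.slice_map φ.toLinearMap η (restitute F k l g)
  rw [AlgHom.toLinearMap_apply] at h2
  rw [← h2]
  have h3 : TensorProduct.map φ.toLinearMap LinearMap.id (restitute F k l g) = 0 := h1
  rw [h3, map_zero]

end Transfer

section Multilinearization

open TensorProduct (slice sliceSubmodule)

variable {F : Type} [Field F] {k l : ℕ}

lemma polarize_mem_mul {A₁ A₂ : Type} [Ring A₁] [Algebra F A₁] [Ring A₂] [Algebra F A₂]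
    (m : Fin k ⊕ Fin l →₀ ℕ) {f : FreeAlgebra F (Fin k ⊕ Fin l)}
    (hf : f ∈ t2Ideal F A₁ k l * t2Ideal F A₂ k l) :
    polarize F m f ∈ sliceSubmodule (polyIdeal F A₁ ℕ * polyIdeal F A₂ ℕ) (Grassmann F) := by
  induction hf using Submodule.mul_induction_on' with
  | mem_mul_mem x hx y hy =>
    rw [map_mul]
    exact TensorProduct.mul_mem_sliceSubmodule (polarize_mem m hx) (polarize_mem m hy)
  | add x _ y _ hx hy => rw [map_add]; exact add_mem hx hy

lemma restitute_mem_mul [Infinite F] {A₁ A₂ : Type} [Ring A₁] [Algebra F A₁] [Ring A₂]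
    [Algebra F A₂] {g : FreeAlgebra F ℕ} (hg : g ∈ polyIdeal F A₁ ℕ * polyIdeal F A₂ ℕ) :
    restitute F k l g ∈
      sliceSubmodule (t2Ideal F A₁ k l * t2Ideal F A₂ k l) (Grassmann F) := by
  induction hg using Submodule.mul_induction_on' with
  | mem_mul_mem x hx y hy =>
    rw [map_mul]
    exact TensorProduct.mul_mem_sliceSubmodule (restitute_mem hx) (restitute_mem hy)
  | add x _ y _ hx hy => rw [map_add]; exact add_mem hx hy

variable (F) in
/-- The coefficient picked up by the generator `s` when an element of multidegree `m` is polarized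
and then restituted. -/
noncomputable def diagCoeff (m : Fin k ⊕ Fin l →₀ ℕ) (s : Fin k ⊕ Fin l) :
    Grassmann F ⊗[F] Grassmann F :=
  ∑ j ∈ Finset.range (m s), grassCoeff F (s, j) ⊗ₜ[F] grassCoeff F (s, j)

variable (F) in
/-- Polarization followed by restitution. -/
noncomputable def polarizeRestitute (m : Fin k ⊕ Fin l →₀ ℕ) :
    FreeAlgebra F (Fin k ⊕ Fin l) →ₐ[F]
      FreeAlgebra F (Fin k ⊕ Fin l) ⊗[F] (Grassmann F ⊗[F] Grassmann F) :=
  (Algebra.TensorProduct.assoc F F F _ (Grassmann F) (Grassmann F)).toAlgHom.comp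
    ((Algebra.TensorProduct.map (restitute F k l) (AlgHom.id F (Grassmann F))).comp
      (polarize F m))

lemma polarizeRestitute_ι (m : Fin k ⊕ Fin l →₀ ℕ) (s : Fin k ⊕ Fin l) :
    polarizeRestitute F m (FreeAlgebra.ι F s) = FreeAlgebra.ι F s ⊗ₜ[F] diagCoeff F m s := by
  simp only [polarizeRestitute, polarize, restitute, AlgHom.comp_apply, FreeAlgebra.lift_ι_apply,
    map_sum, Algebra.TensorProduct.map_tmul, Encodable.encodek, Option.elim_some, diagCoeff,
    TensorProduct.tmul_sum]
  exact Finset.sum_congr rfl fun j _ => by simp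

lemma polarizeRestitute_word (m : Fin k ⊕ Fin l →₀ ℕ) (w : List (Fin k ⊕ Fin l)) :
    polarizeRestitute F m (FreeAlgebra.word F w) =
      FreeAlgebra.word F w ⊗ₜ[F] (w.map (diagCoeff F m)).prod := by
  induction w with
  | nil => simp [Algebra.TensorProduct.one_def]
  | cons s w ih =>
    rw [FreeAlgebra.word_cons, map_mul, ih, polarizeRestitute_ι,
      Algebra.TensorProduct.tmul_mul_tmul, List.map_cons, List.prod_cons]

lemma slice_restitute_slice_polarize (m : Fin k ⊕ Fin l →₀ ℕ) (ξ η : Grassmann F →ₗ[F] F)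
    (f : FreeAlgebra F (Fin k ⊕ Fin l)) :
    slice η (restitute F k l (slice ξ (polarize F m f))) =
      slice (η ∘ₗ slice ξ) (polarizeRestitute F m f) := by
  have h := TensorProduct.slice_map (restitute F k l).toLinearMap ξ (polarize F m f)
  rw [AlgHom.toLinearMap_apply] at h
  rw [← h, TensorProduct.slice_slice]
  rfl

lemma list_prod_map_tmul {R J : Type} [Ring R] [Algebra F R] (L : List J) (e : J → R) :
    (L.map fun j => e j ⊗ₜ[F] e j).prod = (L.map e).prod ⊗ₜ[F] (L.map e).prod := by
  induction L with
  | nil => simp [Algebra.TensorProduct.one_def]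
  | cons j L ih => simp [ih]

lemma tmul_self_ne_zero {M : Type} [AddCommGroup M] [Module F M] {x : M} (hx : x ≠ 0) :
    x ⊗ₜ[F] x ≠ 0 := by
  obtain ⟨η, hη⟩ : ∃ η : M →ₗ[F] F, η x ≠ 0 := by
    by_contra! h
    exact hx ((Module.forall_dual_apply_eq_zero_iff F x).1 h)
  intro h
  have h2 := congrArg (slice η) h
  rw [TensorProduct.slice_tmul, map_zero, smul_eq_zero] at h2
  exact h2.elim hη hx

lemma list_prod_map_eq {S C : Type} [Fintype S] [DecidableEq S] [CommRing C] (u : S → C)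
    (w : List S) : (w.map u).prod = ∏ s, u s ^ FreeAlgebra.multidegree w s := by
  induction w with
  | nil => simp
  | cons t w ih =>
    rw [List.map_cons, List.prod_cons, ih, FreeAlgebra.multidegree_cons]
    simp only [Finsupp.add_apply, pow_add, Finset.prod_mul_distrib]
    rw [mul_comm, Finset.prod_eq_single t (f := fun s => u s ^ (Finsupp.single t 1) s)]
    · simp
    · intro s _ hs
      rw [Finsupp.single_eq_of_ne hs, pow_zero]
    · simp

/-- The product of the coefficients along a word of multidegree `m` depends only on `m`, and does
not vanish. -/
lemma exists_diagCoeff_prod [CharZero F] (m : Fin k ⊕ Fin l →₀ ℕ) :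
    ∃ c : Grassmann F ⊗[F] Grassmann F, c ≠ 0 ∧
      ∀ w, FreeAlgebra.multidegree w = m → (w.map (diagCoeff F m)).prod = c := by
  obtain ⟨C, _, _, i, hi, hC⟩ := exists_commRing_diagonalTensors F
  choose y hy using fun q : (Fin k ⊕ Fin l) × ℕ =>
    hC _ (tmul_mem_diagonalTensors (grassCoeff_mem F q) (grassCoeff_mem F q))
  let u : Fin k ⊕ Fin l → C := fun s => ∑ j ∈ Finset.range (m s), y (s, j)
  have hu : ∀ s, i (u s) = diagCoeff F m s := by
    intro s
    simp only [u, map_sum, hy, diagCoeff]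
  refine ⟨i (∏ s, u s ^ m s), ?_, ?_⟩
  · have hinl : ∀ a : Fin k, u (Sum.inl a) = (m (Sum.inl a) : C) := by
      intro a
      have h1 : ∀ j, y (Sum.inl a, j) = 1 := by
        intro j
        apply hi
        rw [hy, map_one, Algebra.TensorProduct.one_def]
        rfl
      simp [u, h1]
    have hinr : ∀ b : Fin l, u (Sum.inr b) ^ m (Sum.inr b) =
        ((m (Sum.inr b)).factorial : C) *
          ∏ j ∈ Finset.range (m (Sum.inr b)), y (Sum.inr b, j) := by
      intro b
      have h0 : ∀ j, y (Sum.inr b, j) * y (Sum.inr b, j) = 0 := by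
        intro j
        apply hi
        rw [map_mul, hy, map_zero, Algebra.TensorProduct.tmul_mul_tmul]
        simp only [grassCoeff, ExteriorAlgebra.ι_sq_zero, TensorProduct.zero_tmul]
      have h1 := sum_pow_card_of_sq_eq_zero h0 (Finset.range (m (Sum.inr b)))
      rwa [Finset.card_range] at h1
    let N : ℕ := (∏ a : Fin k, m (Sum.inl a) ^ m (Sum.inl a)) *
      ∏ b : Fin l, (m (Sum.inr b)).factorial
    have hN : N ≠ 0 := by
      refine mul_ne_zero (Finset.prod_ne_zero_iff.2 fun a _ => ?_)
        (Finset.prod_ne_zero_iff.2 fun b _ => Nat.factorial_ne_zero _)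
      by_cases h : m (Sum.inl a) = 0
      · simp [h]
      · exact pow_ne_zero _ h
    let J : Finset (Σ _ : Fin l, ℕ) :=
      Finset.univ.sigma fun b => Finset.range (m (Sum.inr b))
    have hprod : ∏ s, u s ^ m s = (N : C) * ∏ p ∈ J, y (Sum.inr p.1, p.2) := by
      rw [Fintype.prod_sum_type, Finset.prod_sigma]
      simp only [hinl, hinr, Finset.prod_mul_distrib, N]
      push_cast
      ring
    let P : Grassmann F := (J.toList.map fun p => grassCoeff F (k := k) (Sum.inr p.1, p.2)).prod
    have hJ : i (∏ p ∈ J, y (Sum.inr p.1, p.2)) = P ⊗ₜ[F] P := by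
      rw [← Finset.prod_map_toList, map_list_prod, List.map_map, ← list_prod_map_tmul]
      simp only [Function.comp_def, hy]
    have hP : P ≠ 0 := by
      have hnd : (J.toList.map fun p => Encodable.encode (p.1, p.2)).Nodup := by
        refine J.nodup_toList.map ?_
        rintro ⟨a, b⟩ ⟨c, d⟩ h
        have := Encodable.encode_injective h
        simp_all
      have h := Grassmann.list_prod_ne_zero (F := F) hnd
      rwa [List.map_map] at h
    rw [hprod, map_mul, hJ, map_natCast, ← nsmul_eq_mul, ← Nat.cast_smul_eq_nsmul F]
    exact smul_ne_zero (Nat.cast_ne_zero.2 hN) (tmul_self_ne_zero hP)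
  · rintro w hw
    rw [← hw, ← list_prod_map_eq, map_list_prod, List.map_map, hw]
    congr 1
    exact List.map_congr_left fun s _ => (hu s).symm

/-- Up to a nonzero scalar, an element of multidegree `m` is recovered from a coefficient of its
polarization. -/
lemma exists_restitute_polarize_eq_smul [CharZero F] (m : Fin k ⊕ Fin l →₀ ℕ) :
    ∃ (ξ η : Grassmann F →ₗ[F] F) (a : F), a ≠ 0 ∧
      ∀ f ∈ wordSpan F (Fin k ⊕ Fin l) m,
        slice η (restitute F k l (slice ξ (polarize F m f))) = a • f := by
  obtain ⟨c, hc, hw⟩ := exists_diagCoeff_prod (F := F) m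
  obtain ⟨ξ, η, hne⟩ := TensorProduct.exists_slice_ne_zero hc
  refine ⟨ξ, η, _, hne, fun f hf => ?_⟩
  rw [slice_restitute_slice_polarize]
  rw [FreeAlgebra.wordSpan_eq] at hf
  induction hf using Submodule.span_induction with
  | mem x h =>
    obtain ⟨w, hwm, rfl⟩ := h
    rw [polarizeRestitute_word, hw w hwm, TensorProduct.slice_tmul, LinearMap.comp_apply]
  | zero => simp
  | add x y _ _ hx hy => rw [map_add, map_add, hx, hy, smul_add]
  | smul b x _ hx => rw [map_smul, map_smul, hx, smul_comm]

lemma t2Ideal_inf_wordSpan [CharZero F] {A A₁ A₂ : Type} [Ring A] [Algebra F A] [Ring A₁]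
    [Algebra F A₁] [Ring A₂] [Algebra F A₂]
    (hT : polyIdeal F A ℕ = polyIdeal F A₁ ℕ * polyIdeal F A₂ ℕ) (m : Fin k ⊕ Fin l →₀ ℕ) :
    t2Ideal F A k l ⊓ wordSpan F (Fin k ⊕ Fin l) m =
      t2Ideal F A₁ k l * t2Ideal F A₂ k l ⊓ wordSpan F (Fin k ⊕ Fin l) m := by
  have : Infinite F := Infinite.of_injective _ (Nat.cast_injective (R := F))
  obtain ⟨ξ, η, a, ha, h⟩ := exists_restitute_polarize_eq_smul (F := F) m
  apply le_antisymm
  · rintro f ⟨hf, hm⟩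
    refine ⟨?_, hm⟩
    have h1 := TensorProduct.mem_sliceSubmodule.1 (polarize_mem m hf) ξ
    rw [hT] at h1
    have h2 := TensorProduct.mem_sliceSubmodule.1 (restitute_mem_mul (k := k) (l := l) h1) η
    rw [h f hm] at h2
    exact (Submodule.smul_mem_iff _ ha).1 h2
  · rintro f ⟨hf, hm⟩
    refine ⟨?_, hm⟩
    have h1 := TensorProduct.mem_sliceSubmodule.1 (polarize_mem_mul m hf) ξ
    rw [← hT] at h1
    have h2 := TensorProduct.mem_sliceSubmodule.1 (restitute_mem (k := k) (l := l) h1) η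
    rw [h f hm] at h2
    exact (Submodule.smul_mem_iff _ ha).1 h2

end Multilinearization

/-- If `T(A) = T(A₁)T(A₂)` then the double Hilbert series satisfy
`H(A) = H(A₁) + H(A₂) + (∑ t_i + ∑ y_s - 1) H(A₁) H(A₂)`. -/
theorem doubleHilbert_of_tideal_mul
    (F : Type) [Field F] [CharZero F]
    (A A₁ A₂ : Type) [Ring A] [Algebra F A] [Ring A₁] [Algebra F A₁] [Ring A₂] [Algebra F A₂]
    (hPIA : polyIdeal F A ℕ ≠ ⊥) (hPIA₁ : polyIdeal F A₁ ℕ ≠ ⊥) (hPIA₂ : polyIdeal F A₂ ℕ ≠ ⊥)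
    (hT : polyIdeal F A ℕ = Submodule.span F
      {x | ∃ f g : FreeAlgebra F ℕ,
        f ∈ polyIdeal F A₁ ℕ ∧ g ∈ polyIdeal F A₂ ℕ ∧ x = f * g})
    (k l : ℕ) :
    doubleHilbert F A k l =
      doubleHilbert F A₁ k l + doubleHilbert F A₂ k l
      + (∑ i : Fin k, MvPowerSeries.X (Sum.inl i) + ∑ s : Fin l, MvPowerSeries.X (Sum.inr s)
          - 1) * doubleHilbert F A₁ k l * doubleHilbert F A₂ k l := by
  have : Infinite F := Infinite.of_injective _ (Nat.cast_injective (R := F))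
  have hT' : polyIdeal F A ℕ = polyIdeal F A₁ ℕ * polyIdeal F A₂ ℕ := by
    rw [hT, Submodule.mul_eq_span_mul_set]
    congr 1
    ext x
    exact ⟨fun ⟨f, g, hf, hg, h⟩ => ⟨f, hf, g, hg, h.symm⟩,
      fun ⟨f, hf, g, hg, h⟩ => ⟨f, g, hf, hg, h.symm⟩⟩
  have h := FreeAlgebra.gradedSeries_mul (U := t2Ideal F A k l)
    (isMultihomogeneous_t2Ideal (A := A₁)) mul_mem_t2Ideal_right
    (isMultihomogeneous_t2Ideal (A := A₂)) mul_mem_t2Ideal_left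
    (t2Ideal_inf_wordSpan hT')
  rwa [Fintype.sum_sum_type] at h
end
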